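/- arXiv:1908.03196 — 4 statements merged into one kernel-verified Lean document; each statement's English description precedes it below -/
import Mathlib

section
/- Let K be a convex body in ℝ³ that is centrally symmetric (K = 2c − K for some point c) and has constant brightness, i.e. vol₂(K | u^⊥) is the same for all unit vectors u. Then K is a closed Euclidean ball. -/
open MeasureTheory

/-- The orthogonal projection (shadow) of a set `A ⊆ ℝ^m` onto the hyperplane
`u^⊥` through the origin orthogonal to `u`. -/
noncomputable def shadow {m : ℕ} (u : EuclideanSpace ℝ (Fin m))
    (A : Set (EuclideanSpace ℝ (Fin m))) : Set (EuclideanSpace ℝ (Fin m)) :=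
  (fun x => (Submodule.orthogonalProjectionOnto ((Submodule.span ℝ {u})ᗮ) x : EuclideanSpace ℝ (Fin m))) '' A

section CbPL1
open MeasureTheory Set
open scoped ENNReal Pointwise

lemma cb_bm1_aux (A B C : Set ℝ) (hA : IsCompact A) (hB : IsCompact B) (hAn : A.Nonempty)
    (hBn : B.Nonempty) (h : ∀ x ∈ A, ∀ y ∈ B, x + y ∈ C) :
    volume A + volume B ≤ volume C := by
  obtain ⟨M, hM, hM'⟩ := hA.exists_isGreatest hAn
  obtain ⟨m, hm, hm'⟩ := hB.exists_isLeast hBn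
  have h1 : (fun x => x + m) '' A ∪ (fun y => M + y) '' B ⊆ C := by
    rintro z (⟨x, hx, rfl⟩ | ⟨y, hy, rfl⟩)
    · exact h x hx m hm
    · exact h M hM y hy
  have h2 : volume ((fun x => x + m) '' A ∪ (fun y => M + y) '' B) =
      volume ((fun x => x + m) '' A) + volume ((fun y => M + y) '' B) := by
    apply measure_union₀
    · exact ((hB.image (by fun_prop)).measurableSet).nullMeasurableSet
    · refine measure_mono_null (t := {M + m}) ?_ (by simp)
      rintro z ⟨⟨x, hx, rfl⟩, ⟨y, hy, hxy⟩⟩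
      have := hM' hx
      have := hm' hy
      simp only [mem_singleton_iff] at *
      linarith
  have h3 := measure_mono (μ := volume) h1
  rw [h2] at h3
  simpa [measure_preimage_add_right, image_add_right, image_add_left] using h3

lemma cb_bm1 (A B C : Set ℝ) (hA : MeasurableSet A) (hB : MeasurableSet B) (hAn : A.Nonempty)
    (hBn : B.Nonempty) (h : ∀ x ∈ A, ∀ y ∈ B, x + y ∈ C) :
    volume A + volume B ≤ volume C := by
  obtain ⟨x0, hx0⟩ := hAn
  obtain ⟨y0, hy0⟩ := hBn
  rw [hA.measure_eq_iSup_isCompact, hB.measure_eq_iSup_isCompact]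
  have key : ∀ (K : Set ℝ), K ⊆ A → IsCompact K → ∀ K', K' ⊆ B → IsCompact K' →
      volume K + volume K' ≤ volume C := by
    intro K hKA hK K' hKB hK'
    have := cb_bm1_aux (insert x0 K) (insert y0 K') C (hK.insert _) (hK'.insert _) (by simp)
      (by simp) (by
        rintro x (rfl | hx) y (rfl | hy)
        · exact h _ hx0 _ hy0
        · exact h _ hx0 _ (hKB hy)
        · exact h _ (hKA hx) _ hy0
        · exact h _ (hKA hx) _ (hKB hy))
    refine le_trans (add_le_add ?_ ?_) this <;> exact measure_mono (subset_insert _ _)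
  have e1 : ∀ K ⊆ A, IsCompact K → volume K + (⨆ K', ⨆ (_ : K' ⊆ B), ⨆ (_ : IsCompact K'), volume K') ≤ volume C := by
    intro K h1 h2
    have : (⨆ K', ⨆ (_ : K' ⊆ B), ⨆ (_ : IsCompact K'), volume K') ≤ volume C - volume K := by
      simp only [iSup_le_iff]
      intro K' h3 h4
      exact ENNReal.le_sub_of_add_le_left h2.measure_lt_top.ne (key K h1 h2 K' h3 h4)
    calc _ ≤ volume K + (volume C - volume K) := by gcongr
      _ = volume C := by
        apply add_tsub_cancel_of_le
        exact le_trans le_self_add (key K h1 h2 ∅ (by simp) (by simp))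
  have hcf : (⨆ K, ⨆ (_ : K ⊆ A), ⨆ (_ : IsCompact K), volume K) + (⨆ K', ⨆ (_ : K' ⊆ B), ⨆ (_ : IsCompact K'), volume K') ≤ volume C := by
    set b := (⨆ K', ⨆ (_ : K' ⊆ B), ⨆ (_ : IsCompact K'), volume K') with hb
    by_cases hbt : b = ∞
    · have := e1 ∅ (by simp) (by simp)
      simp only [measure_empty, zero_add] at this
      rw [hbt] at this
      simp [top_le_iff.mp this]
    · have : (⨆ K, ⨆ (_ : K ⊆ A), ⨆ (_ : IsCompact K), volume K) ≤ volume C - b := by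
        simp only [iSup_le_iff]
        intro K' h3 h4
        exact ENNReal.le_sub_of_add_le_right hbt (e1 K' h3 h4)
      calc _ ≤ (volume C - b) + b := by gcongr
      _ = volume C := by
        apply tsub_add_cancel_of_le
        have := e1 ∅ (by simp) (by simp)
        simpa using this
  exact hcf
end CbPL1

section CbPL2
open MeasureTheory Set
open scoped ENNReal Pointwise

lemma cb_pl1_norm (a b : ℝ) (ha : 0 < a) (hb : 0 < b) (f g h : ℝ → ℝ)
    (hf : Measurable f) (hg : Measurable g) (hh : Measurable h)
    (f0 : ∀ x, 0 ≤ f x) (g0 : ∀ x, 0 ≤ g x) (h0 : ∀ x, 0 ≤ h x)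
    (f1 : ∀ x, f x ≤ 1) (g1 : ∀ x, g x ≤ 1)
    (f2 : ∀ τ < 1, ∃ x, τ < f x) (g2 : ∀ τ < 1, ∃ x, τ < g x)
    (H : ∀ τ, 0 < τ → τ < 1 → ∀ x y, τ < f x → τ < g y → τ < h (a * x + b * y)) :
    ENNReal.ofReal a * (∫⁻ x, ENNReal.ofReal (f x)) + ENNReal.ofReal b * (∫⁻ x, ENNReal.ofReal (g x))
      ≤ ∫⁻ x, ENNReal.ofReal (h x) := by
  rw [lintegral_eq_lintegral_meas_lt volume (Filter.Eventually.of_forall f0) hf.aemeasurable,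
    lintegral_eq_lintegral_meas_lt volume (Filter.Eventually.of_forall g0) hg.aemeasurable,
    lintegral_eq_lintegral_meas_lt volume (Filter.Eventually.of_forall h0) hh.aemeasurable]
  have mf : Measurable fun t : ℝ => volume {x | t < f x} := by
    apply Antitone.measurable
    intro s t hst
    exact measure_mono fun x hx => lt_of_le_of_lt hst hx
  have mg : Measurable fun t : ℝ => volume {x | t < g x} := by
    apply Antitone.measurable
    intro s t hst
    exact measure_mono fun x hx => lt_of_le_of_lt hst hx
  rw [← lintegral_const_mul _ mf, ← lintegral_const_mul _ mg,
    ← lintegral_add_left (mf.const_mul _)]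
  apply setLIntegral_mono' measurableSet_Ioi
  intro τ hτ
  by_cases h1 : τ < 1
  · have key := cb_bm1 (a • {x | τ < f x}) (b • {x | τ < g x}) {x | τ < h x}
      ((measurableSet_lt measurable_const hf).const_smul₀ a)
      ((measurableSet_lt measurable_const hg).const_smul₀ b)
      (Set.Nonempty.smul_set (f2 τ h1)) (Set.Nonempty.smul_set (g2 τ h1)) (by
        rintro _ ⟨x, hx, rfl⟩ _ ⟨y, hy, rfl⟩
        exact H τ hτ h1 x y hx hy)
    rw [Measure.addHaar_smul, Measure.addHaar_smul] at key
    simpa [abs_of_pos ha, abs_of_pos hb] using key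
  · have e1 : {x | τ < f x} = ∅ := by
      ext x; simp; linarith [f1 x]
    have e2 : {x | τ < g x} = ∅ := by
      ext x; simp; linarith [g1 x]
    simp [e1, e2]

lemma cb_pl1_bdd (a b : ℝ) (ha : 0 < a) (hb : 0 < b) (hab : a + b = 1) (f g h : ℝ → ℝ≥0∞)
    (hf : Measurable f) (hg : Measurable g) (hh : Measurable h) (n : ℝ≥0∞) (hn : n ≠ ∞)
    (fn : ∀ x, f x ≤ n) (gn : ∀ x, g x ≤ n)
    (H : ∀ x y, f x ^ a * g y ^ b ≤ h (a * x + b * y)) :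
    (∫⁻ x, f x) ^ a * (∫⁻ x, g x) ^ b ≤ ∫⁻ x, h x := by
  set F := ⨆ x, f x with hF
  set G := ⨆ x, g x with hG
  have Ft : F ≠ ∞ := ne_top_of_le_ne_top hn (iSup_le fn)
  have Gt : G ≠ ∞ := ne_top_of_le_ne_top hn (iSup_le gn)
  by_cases F0 : F = 0
  · have : ∀ x, f x = 0 := by simpa [hF] using F0
    simp [this, ha]
  by_cases G0 : G = 0
  · have : ∀ x, g x = 0 := by simpa [hG] using G0
    simp [this, hb]
  set M := F ^ a * G ^ b with hM
  have Mt : M ≠ ∞ := ENNReal.mul_ne_top (ENNReal.rpow_ne_top_of_nonneg ha.le Ft)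
    (ENNReal.rpow_ne_top_of_nonneg hb.le Gt)
  have M0 : M ≠ 0 := by
    simp [hM, F0, G0, Ft, Gt, ENNReal.rpow_eq_zero_iff]
  have fF : ∀ x, f x / F ≤ 1 := fun x => by
    rw [ENNReal.div_le_iff F0 Ft, one_mul]; exact le_iSup f x
  have gG : ∀ x, g x / G ≤ 1 := fun x => by
    rw [ENNReal.div_le_iff G0 Gt, one_mul]; exact le_iSup g x
  have hlt : ∀ x, min (h x / M) 1 ≠ ∞ := fun x => ne_top_of_le_ne_top ENNReal.one_ne_top (min_le_right _ _)
  have key := cb_pl1_norm a b ha hb (fun x => (f x / F).toReal) (fun x => (g x / G).toReal)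
    (fun x => (min (h x / M) 1).toReal) (by fun_prop) (by fun_prop) (by fun_prop)
    (fun x => ENNReal.toReal_nonneg) (fun x => ENNReal.toReal_nonneg) (fun x => ENNReal.toReal_nonneg)
    (fun x => by simpa using ENNReal.toReal_mono ENNReal.one_ne_top (fF x))
    (fun x => by simpa using ENNReal.toReal_mono ENNReal.one_ne_top (gG x))
    (by
      intro τ hτ
      by_cases h0 : τ < 0
      · exact ⟨0, lt_of_lt_of_le h0 ENNReal.toReal_nonneg⟩
      have : ENNReal.ofReal τ * F < F := by
        conv_rhs => rw [← one_mul F]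
        rw [ENNReal.mul_lt_mul_iff_left F0 Ft]
        simpa using hτ
      obtain ⟨x, hx⟩ := lt_iSup_iff.mp this
      refine ⟨x, ?_⟩
      rw [← ENNReal.ofReal_lt_iff_lt_toReal (not_lt.mp h0) (ne_top_of_le_ne_top ENNReal.one_ne_top (fF x))]
      rwa [ENNReal.lt_div_iff_mul_lt (Or.inl F0) (Or.inl Ft)])
    (by
      intro τ hτ
      by_cases h0 : τ < 0
      · exact ⟨0, lt_of_lt_of_le h0 ENNReal.toReal_nonneg⟩
      have : ENNReal.ofReal τ * G < G := by
        conv_rhs => rw [← one_mul G]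
        rw [ENNReal.mul_lt_mul_iff_left G0 Gt]
        simpa using hτ
      obtain ⟨x, hx⟩ := lt_iSup_iff.mp this
      refine ⟨x, ?_⟩
      rw [← ENNReal.ofReal_lt_iff_lt_toReal (not_lt.mp h0) (ne_top_of_le_ne_top ENNReal.one_ne_top (gG x))]
      rwa [ENNReal.lt_div_iff_mul_lt (Or.inl G0) (Or.inl Gt)])
    (by
      intro τ h0 h1 x y hx hy
      rw [← ENNReal.ofReal_lt_iff_lt_toReal h0.le (ne_top_of_le_ne_top ENNReal.one_ne_top (fF x))] at hx
      rw [← ENNReal.ofReal_lt_iff_lt_toReal h0.le (ne_top_of_le_ne_top ENNReal.one_ne_top (gG y))] at hy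
      rw [← ENNReal.ofReal_lt_iff_lt_toReal h0.le (hlt _), lt_min_iff]
      refine ⟨?_, by simpa using h1⟩
      rw [ENNReal.lt_div_iff_mul_lt (Or.inl M0) (Or.inl Mt)]
      rw [ENNReal.lt_div_iff_mul_lt (Or.inl F0) (Or.inl Ft)] at hx
      rw [ENNReal.lt_div_iff_mul_lt (Or.inl G0) (Or.inl Gt)] at hy
      refine lt_of_lt_of_le ?_ (H x y)
      have e : ENNReal.ofReal τ * M = (ENNReal.ofReal τ * F) ^ a * (ENNReal.ofReal τ * G) ^ b := by
        rw [ENNReal.mul_rpow_of_nonneg _ _ ha.le, ENNReal.mul_rpow_of_nonneg _ _ hb.le, hM]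
        have : ENNReal.ofReal τ = ENNReal.ofReal τ ^ a * ENNReal.ofReal τ ^ b := by
          rw [← ENNReal.rpow_add_of_nonneg _ _ ha.le hb.le, hab, ENNReal.rpow_one]
        conv_lhs => rw [this]
        ring
      rw [e]
      exact ENNReal.mul_lt_mul (ENNReal.rpow_lt_rpow hx ha) (ENNReal.rpow_lt_rpow hy hb))
  simp only [ENNReal.ofReal_toReal (ne_top_of_le_ne_top ENNReal.one_ne_top (fF _)),
    ENNReal.ofReal_toReal (ne_top_of_le_ne_top ENNReal.one_ne_top (gG _)),
    ENNReal.ofReal_toReal (hlt _)] at key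
  have k2 : ∫⁻ x, min (h x / M) 1 ≤ (∫⁻ x, h x) / M := by
    rw [ENNReal.div_eq_inv_mul, ← lintegral_const_mul _ hh]
    refine lintegral_mono fun x => ?_
    rw [← ENNReal.div_eq_inv_mul]; exact min_le_left _ _
  have k3 := key.trans k2
  simp only [div_eq_mul_inv] at k3
  rw [lintegral_mul_const _ hf, lintegral_mul_const _ hg] at k3
  rw [← div_eq_mul_inv, ← div_eq_mul_inv, ← div_eq_mul_inv, ENNReal.le_div_iff_mul_le (Or.inl M0) (Or.inl Mt)] at k3
  refine le_trans ?_ k3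
  have amgm : ((∫⁻ x, f x) / F) ^ a * ((∫⁻ x, g x) / G) ^ b ≤ 
      ENNReal.ofReal a * ((∫⁻ x, f x) / F) + ENNReal.ofReal b * ((∫⁻ x, g x) / G) := by
    by_cases u : (∫⁻ x, f x) / F = ∞
    · rw [u, ENNReal.mul_top (by simpa using ha)]; simp
    by_cases v : (∫⁻ x, g x) / G = ∞
    · rw [v, ENNReal.mul_top (by simpa using hb)]; simp
    rw [← ENNReal.ofReal_toReal u, ← ENNReal.ofReal_toReal v]
    rw [ENNReal.ofReal_rpow_of_nonneg ENNReal.toReal_nonneg ha.le,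
      ENNReal.ofReal_rpow_of_nonneg ENNReal.toReal_nonneg hb.le, ← ENNReal.ofReal_mul (by positivity),
      ← ENNReal.ofReal_mul ha.le, ← ENNReal.ofReal_mul hb.le, ← ENNReal.ofReal_add (by positivity) (by positivity)]
    apply ENNReal.ofReal_le_ofReal
    exact Real.geom_mean_le_arith_mean2_weighted ha.le hb.le ENNReal.toReal_nonneg ENNReal.toReal_nonneg hab
  calc _ = ((∫⁻ x, f x) / F) ^ a * ((∫⁻ x, g x) / G) ^ b * M := by
        have e1 : (∫⁻ x, f x) ^ a = ((∫⁻ x, f x) / F) ^ a * F ^ a := by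
          rw [← ENNReal.mul_rpow_of_nonneg _ _ ha.le, ENNReal.div_mul_cancel F0 Ft]
        have e2 : (∫⁻ x, g x) ^ b = ((∫⁻ x, g x) / G) ^ b * G ^ b := by
          rw [← ENNReal.mul_rpow_of_nonneg _ _ hb.le, ENNReal.div_mul_cancel G0 Gt]
        rw [e1, e2, hM]; ring
    _ ≤ _ := by gcongr

lemma cb_pl1 (a b : ℝ) (ha : 0 < a) (hb : 0 < b) (hab : a + b = 1) (f g h : ℝ → ℝ≥0∞)
    (hf : Measurable f) (hg : Measurable g) (hh : Measurable h)
    (H : ∀ x y, f x ^ a * g y ^ b ≤ h (a * x + b * y)) :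
    (∫⁻ x, f x) ^ a * (∫⁻ x, g x) ^ b ≤ ∫⁻ x, h x := by
  have e : ∀ u : ℝ → ℝ≥0∞, Measurable u →
      Filter.Tendsto (fun n : ℕ => ∫⁻ x, min (u x) n) Filter.atTop (nhds (∫⁻ x, u x)) := by
    intro u hu
    apply lintegral_tendsto_of_tendsto_of_monotone
    · intro n; fun_prop
    · refine Filter.Eventually.of_forall fun x m n hmn => ?_
      exact min_le_min le_rfl (by exact_mod_cast hmn)
    · refine Filter.Eventually.of_forall fun x => ?_
      have := (tendsto_const_nhds (x := u x)).min ENNReal.tendsto_nat_nhds_top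
      simpa using this
  have key : ∀ n : ℕ, (∫⁻ x, min (f x) n) ^ a * (∫⁻ x, min (g x) n) ^ b ≤ ∫⁻ x, h x := by
    intro n
    refine cb_pl1_bdd a b ha hb hab _ _ h (by fun_prop) (by fun_prop) hh n (by simp) 
      (fun x => min_le_right _ _) (fun x => min_le_right _ _) ?_
    intro x y
    refine le_trans ?_ (H x y)
    gcongr <;> exact min_le_left _ _
  by_cases f0 : ∫⁻ x, f x = 0
  · simp [f0, ha]
  by_cases g0 : ∫⁻ x, g x = 0
  · simp [g0, hb]
  refine le_of_tendsto' (b := ∫⁻ x, h x) (x := Filter.atTop) ?_ key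
  apply ENNReal.Tendsto.mul
  · exact (ENNReal.continuous_rpow_const.tendsto _).comp (e f hf)
  · left; simp [ENNReal.rpow_eq_zero_iff, f0, ha.le]
  · exact (ENNReal.continuous_rpow_const.tendsto _).comp (e g hg)
  · left; simp [ENNReal.rpow_eq_zero_iff, g0, hb.le]

/-- Prekopa-Leindler property of a measure. -/
def CbPL (G : Type) [AddCommGroup G] [Module ℝ G] [MeasurableSpace G] (μ : Measure G) : Prop :=
  ∀ (a b : ℝ), 0 < a → 0 < b → a + b = 1 → ∀ f g h : G → ℝ≥0∞, Measurable f → Measurable g →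
    Measurable h → (∀ x y, f x ^ a * g y ^ b ≤ h (a • x + b • y)) →
    (∫⁻ x, f x ∂μ) ^ a * (∫⁻ x, g x ∂μ) ^ b ≤ ∫⁻ x, h x ∂μ

lemma cb_PL_real : CbPL ℝ volume := fun a b ha hb hab f g h hf hg hh H =>
  cb_pl1 a b ha hb hab f g h hf hg hh H

lemma cb_PL_prod (G : Type) [AddCommGroup G] [Module ℝ G] [MeasurableSpace G] (μ : Measure G)
    [SFinite μ] (hG : CbPL G μ) : CbPL (ℝ × G) (volume.prod μ) := by
  intro a b ha hb hab f g h hf hg hh H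
  rw [lintegral_prod _ hf.aemeasurable, lintegral_prod _ hg.aemeasurable,
    lintegral_prod _ hh.aemeasurable]
  apply cb_pl1 a b ha hb hab _ _ _ hf.lintegral_prod_right' hg.lintegral_prod_right'
    hh.lintegral_prod_right'
  intro x y
  apply hG a b ha hb hab
  · exact hf.comp measurable_prodMk_left
  · exact hg.comp measurable_prodMk_left
  · exact hh.comp measurable_prodMk_left
  · intro u v
    exact H (x, u) (y, v)

lemma cb_PL_map (G G' : Type) [AddCommGroup G] [Module ℝ G] [MeasurableSpace G] (μ : Measure G)
    [AddCommGroup G'] [Module ℝ G'] [MeasurableSpace G'] (ν : Measure G')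
    (hG : CbPL G μ) (e : G →ₗ[ℝ] G') (he : MeasurePreserving e μ ν) : CbPL G' ν := by
  intro a b ha hb hab f g h hf hg hh H
  rw [← he.lintegral_comp hf, ← he.lintegral_comp hg, ← he.lintegral_comp hh]
  apply hG a b ha hb hab _ _ _ (hf.comp he.measurable) (hg.comp he.measurable) (hh.comp he.measurable)
  intro x y
  simpa using H (e x) (e y)

lemma cb_PL_set (G : Type) [AddCommGroup G] [Module ℝ G] [MeasurableSpace G] (μ : Measure G)
    (hG : CbPL G μ) (a b : ℝ) (ha : 0 < a) (hb : 0 < b) (hab : a + b = 1) (A B C : Set G)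
    (hA : MeasurableSet A) (hB : MeasurableSet B) (hC : MeasurableSet C)
    (H : ∀ x ∈ A, ∀ y ∈ B, a • x + b • y ∈ C) : μ A ^ a * μ B ^ b ≤ μ C := by
  have := hG a b ha hb hab (A.indicator 1) (B.indicator 1) (C.indicator 1)
    (measurable_one.indicator hA) (measurable_one.indicator hB) (measurable_one.indicator hC) (by
      intro x y
      by_cases hx : x ∈ A
      · by_cases hy : y ∈ B
        · simp [hx, hy, H x hx y hy]
        · simp [hx, hy, hb]
      · simp [hx, ha])
  simpa [lintegral_indicator_one, hA, hB, hC] using this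
end CbPL2

section CbA1
open MeasureTheory Set
open scoped ENNReal Pointwise

abbrev CbE := EuclideanSpace ℝ (Fin 3)
noncomputable abbrev CbV (u : CbE) : Submodule ℝ CbE := (Submodule.span ℝ {u})ᗮ

noncomputable def cbPsi (u : CbE) : ℝ × CbV u →ₗ[ℝ] CbE :=
  LinearMap.coprod (LinearMap.toSpanSingleton ℝ CbE u) (CbV u).subtype

lemma cbPsi_apply (u : CbE) (p : ℝ × CbV u) : cbPsi u p = p.1 • u + p.2 := by
  simp [cbPsi]

lemma cbV_inner (u : CbE) (y : CbV u) : inner ℝ u (y : CbE) = 0 :=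
  Submodule.mem_orthogonal_singleton_iff_inner_right.mp y.2

lemma cbPsi_norm (u : CbE) (hu : ‖u‖ = 1) (p : ℝ × CbV u) :
    ‖cbPsi u p‖ ^ 2 = p.1 ^ 2 + ‖p.2‖ ^ 2 := by
  rw [cbPsi_apply, norm_add_sq_real, inner_smul_left, cbV_inner, norm_smul, hu]
  simp

lemma cbV_finrank (u : CbE) (hu : ‖u‖ = 1) : Module.finrank ℝ (CbV u) = 2 := by
  have h0 : u ≠ 0 := by rintro rfl; simp at hu
  have : Fact (Module.finrank ℝ CbE = 2 + 1) := ⟨by simp⟩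
  exact Submodule.finrank_orthogonal_span_singleton h0

noncomputable def cbIso (u : CbE) (hu : ‖u‖ = 1) : WithLp 2 (ℝ × CbV u) →ₗᵢ[ℝ] CbE where
  toLinearMap := (cbPsi u) ∘ₗ (WithLp.linearEquiv 2 ℝ (ℝ × CbV u)).toLinearMap
  norm_map' := by
    intro x
    have h1 := cbPsi_norm u hu x.ofLp
    have h2 := WithLp.prod_norm_sq_eq_of_L2 x
    rw [← sq_eq_sq₀ (norm_nonneg _) (norm_nonneg _), h2]
    simpa using h1

lemma cbPsi_mp (u : CbE) (hu : ‖u‖ = 1) : MeasurePreserving (cbPsi u) volume volume := by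
  have hf : Module.finrank ℝ (WithLp 2 (ℝ × CbV u)) = Module.finrank ℝ CbE := by
    rw [(WithLp.linearEquiv 2 ℝ (ℝ × CbV u)).finrank_eq]
    simp [cbV_finrank u hu]
  have h1 := ((cbIso u hu).toLinearIsometryEquiv hf).measurePreserving
  have h2 := WithLp.volume_preserving_toLp (U := ℝ) (V := CbV u)
  exact h1.comp h2

lemma cbPsi_cont (u : CbE) : Continuous (cbPsi u) := by
  have : (cbPsi u : ℝ × CbV u → CbE) = fun p => p.1 • u + (p.2 : CbE) := by
    ext1 p; exact cbPsi_apply u p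
  rw [this]; fun_prop

lemma cbPsi_inj (u : CbE) (hu : ‖u‖ = 1) : Function.Injective (cbPsi u) := by
  rw [injective_iff_map_eq_zero]
  intro p hp
  have := cbPsi_norm u hu p
  rw [hp] at this
  simp only [norm_zero] at this
  have h1 : p.1 = 0 := by nlinarith [sq_nonneg p.1, sq_nonneg ‖p.2‖]
  have h2 : ‖p.2‖ = 0 := by nlinarith [sq_nonneg p.1, sq_nonneg ‖p.2‖]
  exact Prod.ext h1 (norm_eq_zero.mp h2)

lemma cbPsi_closedEmb (u : CbE) (hu : ‖u‖ = 1) : Topology.IsClosedEmbedding (cbPsi u) :=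
  LinearMap.isClosedEmbedding_of_injective (LinearMap.ker_eq_bot.mpr (cbPsi_inj u hu))

lemma cbPsi_surj (u : CbE) (hu : ‖u‖ = 1) : Function.Surjective (cbPsi u) := by
  refine (LinearMap.injective_iff_surjective_of_finrank_eq_finrank ?_).mp (cbPsi_inj u hu)
  simp [cbV_finrank u hu]

lemma cbPsi_inner (u : CbE) (hu : ‖u‖ = 1) (p : ℝ × CbV u) : inner ℝ u (cbPsi u p) = p.1 := by
  rw [cbPsi_apply, inner_add_right, inner_smul_right, cbV_inner, real_inner_self_eq_norm_sq, hu]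
  simp

lemma cbPsi_proj (u : CbE) (p : ℝ × CbV u) :
    (CbV u).orthogonalProjectionOnto (cbPsi u p) = p.2 := by
  rw [cbPsi_apply, map_add]
  have : (CbV u).orthogonalProjectionOnto (p.1 • u) = 0 := by
    rw [Submodule.orthogonalProjectionOnto_eq_zero_iff]
    apply Submodule.le_orthogonal_orthogonal
    exact Submodule.smul_mem _ _ (Submodule.mem_span_singleton_self u)
  simp [this]

noncomputable def cbProj (u : CbE) (X : Set CbE) : Set (CbV u) :=
  (CbV u).orthogonalProjectionOnto '' X

lemma cb_vol_fiber (u : CbE) (hu : ‖u‖ = 1) (X : Set CbE) (hX : IsCompact X) :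
    volume X = ∫⁻ y : CbV u, volume {s : ℝ | cbPsi u (s, y) ∈ X} := by
  have hm : MeasurableSet (cbPsi u ⁻¹' X) := (cbPsi_cont u).measurable hX.measurableSet
  rw [← (cbPsi_mp u hu).measure_preimage hX.measurableSet.nullMeasurableSet,
    Measure.volume_eq_prod, Measure.prod_apply_symm hm]
  rfl

lemma cb_vol_seg (u : CbE) (hu : ‖u‖ = 1) (X : Set CbE) (hX : IsCompact X) (hc : Convex ℝ X)
    (t : ℝ) (ht : 0 ≤ t) : volume (X + segment ℝ (-(t • u)) (t • u)) =
      volume X + ENNReal.ofReal (2 * t) * volume (cbProj u X) := by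
  have hseg : segment ℝ (-(t • u)) (t • u) = (fun s : ℝ => s • u) '' (Icc (-t) t) := by
    have := image_segment ℝ (LinearMap.toSpanSingleton ℝ CbE u).toAffineMap (-t) t
    rw [segment_eq_Icc (by linarith)] at this
    simpa using this.symm
  have hcs : IsCompact (segment ℝ (-(t • u)) (t • u)) := by
    rw [hseg]; exact isCompact_Icc.image (by fun_prop)
  have hP : IsCompact (cbProj u X) := hX.image (by fun_prop)
  rw [cb_vol_fiber u hu _ (hX.add hcs), cb_vol_fiber u hu X hX]
  rw [← setLIntegral_one (cbProj u X), ← lintegral_indicator hP.measurableSet,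
    ← lintegral_const_mul _ (by exact measurable_one.indicator hP.measurableSet)]
  have hmm : Measurable fun y : CbV u => ENNReal.ofReal (2 * t) *
      (cbProj u X).indicator (fun _ => (1 : ℝ≥0∞)) y :=
    (measurable_one.indicator hP.measurableSet).const_mul _
  rw [← lintegral_add_right _ hmm]
  congr 1
  ext y
  have hfib : {s : ℝ | cbPsi u (s, y) ∈ X + segment ℝ (-(t • u)) (t • u)} =
      {s : ℝ | cbPsi u (s, y) ∈ X} + Icc (-t) t := by
    ext s
    rw [hseg]
    simp only [mem_setOf_eq, mem_add, mem_image]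
    constructor
    · rintro ⟨x, hx, z, ⟨w, hw, rfl⟩, h⟩
      refine ⟨s - w, ?_, w, hw, by ring⟩
      convert hx using 1
      rw [cbPsi_apply] at h ⊢
      simp only [sub_smul]
      rw [← sub_eq_iff_eq_add] at h
      · rw [← sub_eq_zero]; rw [← sub_eq_zero] at h; rw [← neg_eq_zero, ← h]; abel
    · rintro ⟨s', hs', w, hw, rfl⟩
      refine ⟨_, hs', _, ⟨w, hw, rfl⟩, ?_⟩
      simp [cbPsi_apply, add_smul]; abel
  rw [hfib]
  by_cases hy : y ∈ cbProj u X
  · have hne : {s : ℝ | cbPsi u (s, y) ∈ X}.Nonempty := by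
      obtain ⟨x, hx, rfl⟩ := hy
      obtain ⟨p, rfl⟩ := cbPsi_surj u hu x
      refine ⟨p.1, ?_⟩
      rw [cbPsi_proj]; exact hx
    have hcomp : IsCompact {s : ℝ | cbPsi u (s, y) ∈ X} := by
      have h1 : IsCompact (cbPsi u ⁻¹' X) := (cbPsi_closedEmb u hu).isCompact_preimage hX
      have : {s : ℝ | cbPsi u (s, y) ∈ X} = Prod.fst '' ((cbPsi u ⁻¹' X) ∩ {p | p.2 = y}) := by
        ext s
        constructor
        · intro h; exact ⟨(s, y), ⟨h, rfl⟩, rfl⟩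
        · rintro ⟨⟨s, y'⟩, ⟨h, rfl⟩, rfl⟩; exact h
      rw [this]
      exact (h1.inter_right (isClosed_eq continuous_snd continuous_const)).image continuous_fst
    have hconv : Convex ℝ {s : ℝ | cbPsi u (s, y) ∈ X} := by
      intro s hs s' hs' a b ha hb hab
      have := hc hs hs' ha hb hab
      simp only [mem_setOf_eq]
      convert this using 1
      rw [← map_smul, ← map_smul, ← map_add]
      congr 1
      ext1
      · simp
      · simp [← add_smul, hab]
    have := eq_Icc_of_connected_compact (hconv.isConnected hne) hcomp
    obtain ⟨α, β, hab⟩ : ∃ α β, {s : ℝ | cbPsi u (s, y) ∈ X} = Icc α β := ⟨_, _, this⟩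
    rw [hab] at hne ⊢
    have hle : α ≤ β := nonempty_Icc.mp hne
    have hsum : Icc α β + Icc (-t) t = Icc (α - t) (β + t) := by
      rw [Icc_add_Icc hle (by linarith)]; simp [sub_eq_add_neg]
    rw [hsum]
    simp [hy]
    rw [← ENNReal.ofReal_ofNat, ← ENNReal.ofReal_mul (by norm_num), ← ENNReal.ofReal_add (by linarith) (by linarith)]
    congr 1; ring
  · have he : {s : ℝ | cbPsi u (s, y) ∈ X} = ∅ := by
      ext s
      simp only [mem_setOf_eq, mem_empty_iff_false, iff_false]
      intro h
      exact hy ⟨_, h, cbPsi_proj u (s, y)⟩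
    simp [he, hy]
end CbA1

section CbB1
open MeasureTheory Set Filter Topology
open scoped ENNReal Pointwise

noncomputable def cbSeg (u : CbE) : Set CbE := segment ℝ (-u) u
noncomputable def cbZ (l : List CbE) : Set CbE := (l.map cbSeg).sum
noncomputable def cbLen (l : List CbE) : ℝ := (l.map norm).sum
noncomputable def cbVol (X : Set CbE) : ℝ := (volume X).toReal
def CbBr (X : Set CbE) (b : ℝ) : Prop := ∀ u : CbE, cbVol (X + cbSeg u) - cbVol X = b * ‖u‖

lemma cbSeg_compact (u : CbE) : IsCompact (cbSeg u) := by
  unfold cbSeg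
  rw [segment_eq_image]
  exact isCompact_Icc.image (by fun_prop)

lemma cbSeg_smul (t : ℝ) (u : CbE) : t • cbSeg u = cbSeg (t • u) := by
  unfold cbSeg
  have := image_segment ℝ (LinearMap.lsmul ℝ CbE t).toAffineMap (-u) u
  rw [← image_smul]
  simp at this
  exact this

lemma cbSeg_nonempty (u : CbE) : (cbSeg u).Nonempty := ⟨u, right_mem_segment _ _ _⟩

lemma cbZ_cons (u : CbE) (l : List CbE) : cbZ (u :: l) = cbSeg u + cbZ l := by simp [cbZ]
lemma cbZ_append (l l' : List CbE) : cbZ (l ++ l') = cbZ l + cbZ l' := by simp [cbZ]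
lemma cbLen_append (l l' : List CbE) : cbLen (l ++ l') = cbLen l + cbLen l' := by simp [cbLen]

lemma cbZ_props (l : List CbE) : IsCompact (cbZ l) ∧ Convex ℝ (cbZ l) ∧ (cbZ l).Nonempty := by
  induction l with
  | nil =>
    have : cbZ [] = {0} := by simp [cbZ]; rfl
    rw [this]; exact ⟨isCompact_singleton, convex_singleton _, singleton_nonempty _⟩
  | cons u l ih =>
    rw [cbZ_cons]
    exact ⟨(cbSeg_compact u).add ih.1, (convex_segment _ _).add ih.2.1, (cbSeg_nonempty u).add ih.2.2⟩

lemma cbVol_mono {X Y : Set CbE} (h : X ⊆ Y) (hY : IsCompact Y) : cbVol X ≤ cbVol Y :=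
  ENNReal.toReal_mono hY.measure_lt_top.ne (measure_mono h)

lemma cb_seg_unit (u : CbE) (hu : ‖u‖ = 1) (X : Set CbE) (hX : IsCompact X) (hc : Convex ℝ X)
    (t : ℝ) (ht : 0 ≤ t) :
    cbVol (X + cbSeg (t • u)) - cbVol X = 2 * t * (volume (cbProj u X)).toReal := by
  have hP : IsCompact (cbProj u X) := hX.image (by fun_prop)
  unfold cbVol cbSeg
  rw [cb_vol_seg u hu X hX hc t ht, ENNReal.toReal_add hX.measure_lt_top.ne
    (ENNReal.mul_ne_top ENNReal.ofReal_ne_top hP.measure_lt_top.ne)]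
  rw [ENNReal.toReal_mul, ENNReal.toReal_ofReal (by positivity)]
  ring

lemma cbSeg_zero : cbSeg 0 = 0 := by
  unfold cbSeg; simp; rfl

lemma cb_seg_homog (u : CbE) (X : Set CbE) (hX : IsCompact X) (hc : Convex ℝ X)
    (t : ℝ) (ht : 0 ≤ t) :
    cbVol (X + cbSeg (t • u)) - cbVol X = t * (cbVol (X + cbSeg u) - cbVol X) := by
  by_cases h : u = 0
  · subst h; simp [cbSeg_zero]
  have h0 : ‖u‖ ≠ 0 := by simpa using h
  have h1 : ‖(‖u‖⁻¹ • u)‖ = 1 := by rw [norm_smul]; simp [h0]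
  have e1 : u = ‖u‖ • (‖u‖⁻¹ • u) := by rw [smul_smul]; simp [h0]
  have a1 := cb_seg_unit _ h1 X hX hc (t * ‖u‖) (by positivity)
  have a2 := cb_seg_unit _ h1 X hX hc ‖u‖ (by positivity)
  rw [← e1] at a2
  rw [mul_smul, ← e1] at a1
  rw [a1, a2]; ring

lemma cb_vol_cont (Y M : Set CbE) (hY : IsCompact Y) (hM : IsCompact M) (hMn : M.Nonempty) :
    Tendsto (fun s : ℝ => cbVol (Y + s • M)) (𝓝[>] 0) (𝓝 (cbVol Y)) := by
  obtain ⟨R, hR0, hR⟩ : ∃ R, 0 < R ∧ M ⊆ Metric.closedBall 0 R := by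
    obtain ⟨R, hR⟩ := hM.isBounded.subset_closedBall 0
    exact ⟨max R 1, by simp, hR.trans (Metric.closedBall_subset_closedBall (le_max_left _ _))⟩
  have h1 : Tendsto (fun s : ℝ => (volume (Metric.cthickening (R * s) Y)).toReal) (𝓝[>] 0) (𝓝 (cbVol Y)) := by
    have := tendsto_measure_cthickening_of_isCompact (μ := volume) hY
    refine (ENNReal.tendsto_toReal hY.measure_lt_top.ne).comp (this.comp ?_)
    have : Tendsto (fun s : ℝ => R * s) (𝓝 0) (𝓝 (R * 0)) := (continuous_const.mul continuous_id).tendsto 0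
    rw [mul_zero] at this
    exact this.mono_left nhdsWithin_le_nhds
  refine tendsto_of_tendsto_of_tendsto_of_le_of_le' tendsto_const_nhds h1 ?_ ?_
  · filter_upwards with s
    obtain ⟨m, hm⟩ := hMn
    have : cbVol Y = cbVol ((fun x => x + s • m) '' Y) := by simp [cbVol]
    rw [this]
    refine cbVol_mono ?_ (hY.add (hM.smul s))
    rintro _ ⟨x, hx, rfl⟩
    exact add_mem_add hx (smul_mem_smul_set hm)
  · filter_upwards [self_mem_nhdsWithin] with s hs
    refine cbVol_mono ?_ (hY.cthickening)
    rintro _ ⟨x, hx, _, ⟨m, hm, rfl⟩, rfl⟩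
    refine Metric.mem_cthickening_of_dist_le _ x _ _ hx ?_
    have hm' := hR hm
    simp only [Metric.mem_closedBall, dist_zero_right] at hm'
    have : (0:ℝ) < s := hs
    simp only [dist_self_add_left, norm_smul, Real.norm_eq_abs, abs_of_pos this]
    nlinarith

lemma cb_deriv (X : Set CbE) (b : ℝ) (hX : IsCompact X) (hc : Convex ℝ X) (hb : CbBr X b)
    (M : Set CbE) (hM : IsCompact M) (hMc : Convex ℝ M) (hMn : M.Nonempty) (l : List CbE) :
    Tendsto (fun s : ℝ => (cbVol (X + s • (M + cbZ l)) - cbVol (X + s • M)) / s) (𝓝[>] 0)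
      (𝓝 (b * cbLen l)) := by
  induction l with
  | nil =>
    have : cbZ [] = 0 := by simp [cbZ]
    simp [this, cbLen]
  | cons u l ih =>
    obtain ⟨z1, z2, z3⟩ := cbZ_props l
    have h1 := cb_vol_cont (X + cbSeg u) (M + cbZ l) (hX.add (cbSeg_compact u)) (hM.add z1) (hMn.add z3)
    have h2 := cb_vol_cont X (M + cbZ l) hX (hM.add z1) (hMn.add z3)
    have h3 := ih.add (h1.sub h2)
    rw [hb u] at h3
    have e : b * cbLen (u :: l) = b * cbLen l + b * ‖u‖ := by simp [cbLen]; ring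
    rw [e]
    refine h3.congr' ?_
    filter_upwards [self_mem_nhdsWithin] with s hs
    have hs : (0:ℝ) < s := hs
    have h4 := cb_seg_homog u (X + s • (M + cbZ l)) (hX.add ((hM.add z1).smul s))
      (hc.add ((hMc.add z2).smul s)) s hs.le
    have e1 : X + s • (M + cbZ (u :: l)) = X + s • (M + cbZ l) + cbSeg (s • u) := by
      rw [cbZ_cons, ← cbSeg_smul, add_assoc, ← smul_add]
      congr 2
      rw [add_assoc, add_comm (cbZ l)]
    rw [e1]
    have e2 : X + cbSeg u + s • (M + cbZ l) = X + s • (M + cbZ l) + cbSeg u := by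
      rw [add_assoc, add_comm (cbSeg u), ← add_assoc]
    rw [e2]
    rw [div_add' _ _ _ hs.ne', div_left_inj' hs.ne']
    linarith

noncomputable def cbQ (ε : ℝ) : List CbE :=
  [ε • EuclideanSpace.single 0 1, ε • EuclideanSpace.single 1 1, ε • EuclideanSpace.single 2 1]

lemma cbQ_len (ε : ℝ) (h : 0 ≤ ε) : cbLen (cbQ ε) = 3 * ε := by
  simp [cbLen, cbQ, norm_smul, abs_of_nonneg h]; ring

lemma cb_approx_bound (L : Set CbE) (hL : IsCompact L) (hLc : Convex ℝ L) (hLn : L.Nonempty)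
    (ε : ℝ) (hε : 0 < ε) (P N : List CbE) (h1 : L + cbZ N ⊆ cbZ P + cbZ (cbQ ε))
    (h2 : cbZ P ⊆ L + cbZ N + cbZ (cbQ ε))
    (X : Set CbE) (b : ℝ) (hX : IsCompact X) (hc : Convex ℝ X) (hb : CbBr X b) :
    ∀ᶠ s in 𝓝[>] (0:ℝ), |(cbVol (X + s • L) - cbVol X) / s - b * (cbLen P - cbLen N)|
      ≤ 3 * b * ε + 2 * ε := by
  have d1 := cb_deriv X b hX hc hb L hL hLc hLn N
  have d2 := cb_deriv X b hX hc hb L hL hLc hLn (N ++ cbQ ε)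
  have d3 := cb_deriv X b hX hc hb {0} isCompact_singleton (convex_singleton _) (singleton_nonempty _) P
  have d4 := cb_deriv X b hX hc hb {0} isCompact_singleton (convex_singleton _) (singleton_nonempty _) (P ++ cbQ ε)
  have z : ({0} : Set CbE) = 0 := rfl
  simp only [z, smul_zero, add_zero, zero_add, cbLen_append, cbQ_len ε hε.le] at d1 d2 d3 d4
  rw [Metric.tendsto_nhds] at d1 d2 d3 d4
  filter_upwards [d1 ε hε, d2 ε hε, d3 ε hε, d4 ε hε, self_mem_nhdsWithin] with s e1 e2 e3 e4 hs
  have hs : (0:ℝ) < s := hs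
  rw [Real.dist_eq, abs_lt] at e1 e2 e3 e4
  have m1 : cbVol (X + s • (L + cbZ N)) ≤ cbVol (X + s • cbZ (P ++ cbQ ε)) := by
    refine cbVol_mono (add_subset_add_left (smul_set_mono ?_)) (hX.add ((cbZ_props _).1.smul s))
    rw [cbZ_append]; exact h1
  have m2 : cbVol (X + s • cbZ P) ≤ cbVol (X + s • (L + cbZ (N ++ cbQ ε))) := by
    refine cbVol_mono (add_subset_add_left (smul_set_mono ?_)) (hX.add ((hL.add (cbZ_props _).1).smul s))
    rw [cbZ_append, ← add_assoc]; exact h2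
  have m1' : (cbVol (X + s • (L + cbZ N)) - cbVol X) / s ≤ (cbVol (X + s • cbZ (P ++ cbQ ε)) - cbVol X) / s := by
    gcongr
  have m2' : (cbVol (X + s • cbZ P) - cbVol X) / s ≤ (cbVol (X + s • (L + cbZ (N ++ cbQ ε))) - cbVol X) / s := by
    gcongr
  simp only [sub_div] at *
  rw [abs_le]
  constructor <;> linarith [e1.1, e1.2, e2.1, e2.2, e3.1, e3.2, e4.1, e4.2]

lemma cb_mixed (L : Set CbE) (hL : IsCompact L) (hLc : Convex ℝ L) (hLn : L.Nonempty)
    (happ : ∀ ε > 0, ∃ P N : List CbE, L + cbZ N ⊆ cbZ P + cbZ (cbQ ε) ∧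
      cbZ P ⊆ L + cbZ N + cbZ (cbQ ε))
    (X Y : Set CbE) (b : ℝ) (hX : IsCompact X) (hc : Convex ℝ X) (hb : CbBr X b)
    (hY : IsCompact Y) (hcY : Convex ℝ Y) (hbY : CbBr Y b) (d : ℝ)
    (hd : Tendsto (fun s : ℝ => (cbVol (Y + s • L) - cbVol Y) / s) (𝓝[>] 0) (𝓝 d)) :
    Tendsto (fun s : ℝ => (cbVol (X + s • L) - cbVol X) / s) (𝓝[>] 0) (𝓝 d) := by
  have hb0 : 0 ≤ b := by
    have h1 := hb (EuclideanSpace.single 0 1)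
    have h2 : cbVol X ≤ cbVol (X + cbSeg (EuclideanSpace.single 0 1)) := by
      refine cbVol_mono ?_ (hX.add (cbSeg_compact _))
      intro x hx
      refine ⟨x, hx, 0, ?_, by simp⟩
      unfold cbSeg
      exact ⟨1/2, 1/2, by norm_num, by norm_num, by norm_num, by simp⟩
    simp at h1
    linarith
  rw [Metric.tendsto_nhds] at hd ⊢
  intro δ hδ
  set ε := δ / (2 * (6 * b + 4 + 1)) with hε
  have hε0 : 0 < ε := by positivity
  obtain ⟨P, N, h1, h2⟩ := happ ε hε0
  filter_upwards [cb_approx_bound L hL hLc hLn ε hε0 P N h1 h2 X b hX hc hb,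
    cb_approx_bound L hL hLc hLn ε hε0 P N h1 h2 Y b hY hcY hbY, hd (δ/2) (by positivity)] with s e1 e2 e3
  rw [Real.dist_eq, abs_lt] at *
  rw [abs_le] at e1 e2
  have : (6 * b + 4 + 1) * ε = δ / 2 := by
    rw [hε]; field_simp
  constructor <;> nlinarith [e1.1, e1.2, e2.1, e2.2, e3.1, e3.2]
end CbB1

section CbC1
open MeasureTheory Set Filter Topology
open scoped ENNReal Pointwise

noncomputable def cbH (l : List CbE) (v : CbE) : ℝ := (l.map (fun u => |inner ℝ u v|)).sum

lemma cbSeg_le (u v z : CbE) (hz : z ∈ cbSeg u) : inner ℝ z v ≤ |inner ℝ u v| := by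
  obtain ⟨a, b, ha, hb, hab, rfl⟩ := hz
  rw [inner_add_left, inner_smul_left, inner_smul_left, inner_neg_left]
  simp only [conj_trivial]
  have h1 := le_abs_self (inner ℝ u v)
  have h2 := neg_abs_le (inner ℝ u v)
  have e : |inner ℝ u v| = a * |inner ℝ u v| + b * |inner ℝ u v| := by rw [← add_mul, hab, one_mul]
  rw [e]
  nlinarith

lemma cbSeg_attain (u v : CbE) : ∃ z ∈ cbSeg u, inner ℝ z v = |inner ℝ u v| := by
  rcases le_total 0 (inner ℝ u v) with h | h
  · exact ⟨u, right_mem_segment _ _ _, by rw [abs_of_nonneg h]⟩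
  · exact ⟨-u, left_mem_segment _ _ _, by rw [abs_of_nonpos h, inner_neg_left]⟩

lemma cbZ_le (l : List CbE) (v : CbE) : ∀ z ∈ cbZ l, inner ℝ z v ≤ cbH l v := by
  induction l with
  | nil =>
    intro z hz
    have : z = 0 := by simpa [cbZ] using hz
    simp [this, cbH]
  | cons u l ih =>
    rw [cbZ_cons]
    rintro _ ⟨x, hx, y, hy, rfl⟩
    rw [inner_add_left]
    have : cbH (u :: l) v = |inner ℝ u v| + cbH l v := by simp [cbH]
    rw [this]
    exact add_le_add (cbSeg_le u v x hx) (ih y hy)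

lemma cbZ_attain (l : List CbE) (v : CbE) : ∃ z ∈ cbZ l, inner ℝ z v = cbH l v := by
  induction l with
  | nil => exact ⟨0, by simp [cbZ], by simp [cbH]⟩
  | cons u l ih =>
    obtain ⟨x, hx, ex⟩ := cbSeg_attain u v
    obtain ⟨y, hy, ey⟩ := ih
    refine ⟨x + y, by rw [cbZ_cons]; exact add_mem_add hx hy, ?_⟩
    rw [inner_add_left, ex, ey]; simp [cbH]

lemma cbQ_ge (ε : ℝ) (hε : 0 ≤ ε) (v : CbE) : ε * ‖v‖ ≤ cbH (cbQ ε) v := by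
  have : cbH (cbQ ε) v = ε * (|v 0| + |v 1| + |v 2|) := by
    simp [cbH, cbQ, inner_smul_left, abs_mul, abs_of_nonneg hε, EuclideanSpace.inner_single_left]
    ring
  rw [this]
  gcongr
  rw [EuclideanSpace.norm_eq, Fin.sum_univ_three]
  apply Real.sqrt_le_iff.mpr
  constructor
  · positivity
  · simp only [Real.norm_eq_abs]
    nlinarith [abs_nonneg (v 0), abs_nonneg (v 1), abs_nonneg (v 2),
      mul_nonneg (abs_nonneg (v 0)) (abs_nonneg (v 1)), mul_nonneg (abs_nonneg (v 0)) (abs_nonneg (v 2)),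
      mul_nonneg (abs_nonneg (v 1)) (abs_nonneg (v 2))]

lemma cb_subset (X Y : Set CbE) (hY : IsCompact Y) (hc : Convex ℝ Y) (hn : Y.Nonempty)
    (h : ∀ v : CbE, ‖v‖ = 1 → ∀ x ∈ X, ∃ y ∈ Y, inner ℝ x v ≤ inner ℝ y v) : X ⊆ Y := by
  intro x hx
  by_contra hxY
  obtain ⟨f, c, h1, h2⟩ := geometric_hahn_banach_point_closed hc hY.isClosed hxY
  set w := (InnerProductSpace.toDual ℝ CbE).symm f with hw
  have hf : ∀ z, f z = inner ℝ z w := by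
    intro z
    rw [real_inner_comm, hw, InnerProductSpace.toDual_symm_apply]
  have w0 : w ≠ 0 := by
    intro h0
    obtain ⟨y, hy⟩ := hn
    have := h2 y hy
    rw [hf, h0] at h1 this
    simp at h1 this
    linarith
  have wn : 0 < ‖w‖ := norm_pos_iff.mpr w0
  obtain ⟨y, hy, hxy⟩ := h (-(‖w‖⁻¹ • w)) (by rw [norm_neg, norm_smul]; simp [wn.ne']) x hx
  simp only [inner_neg_right, inner_smul_right, ← hf] at hxy
  have h3 := h2 y hy
  have : ‖w‖⁻¹ * f x < ‖w‖⁻¹ * f y := by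
    apply mul_lt_mul_of_pos_left (by linarith) (by positivity)
  linarith

abbrev CbS := Metric.sphere (0 : CbE) 1

noncomputable def cbPhi (u : CbE) : C(CbS, ℝ) := ⟨fun v => |inner ℝ u (v : CbE)|, by fun_prop⟩

noncomputable def cbW : Submodule ℝ C(CbS, ℝ) :=
  (Submodule.span ℝ (range cbPhi)).topologicalClosure

lemma cbH_smul (c : ℝ) (l : List CbE) (v : CbE) : cbH (l.map (fun u => c • u)) v = |c| * cbH l v := by
  simp only [cbH, List.map_map, Function.comp_def, inner_smul_left, abs_mul, conj_trivial, List.sum_map_mul_left]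

lemma cbH_append (l l' : List CbE) (v : CbE) : cbH (l ++ l') v = cbH l v + cbH l' v := by
  simp [cbH]

lemma cb_span_lists (g : C(CbS, ℝ)) (hg : g ∈ Submodule.span ℝ (range cbPhi)) :
    ∃ P N : List CbE, ∀ v : CbS, g v = cbH P v - cbH N v := by
  induction hg using Submodule.span_induction with
  | mem x h =>
    obtain ⟨u, rfl⟩ := h
    exact ⟨[u], [], fun v => by simp [cbH, cbPhi]⟩
  | zero => exact ⟨[], [], fun v => by simp⟩
  | add x y hx hy ihx ihy =>
    obtain ⟨P, N, h⟩ := ihx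
    obtain ⟨P', N', h'⟩ := ihy
    refine ⟨P ++ P', N ++ N', fun v => ?_⟩
    rw [ContinuousMap.add_apply, h, h', cbH_append, cbH_append]; ring
  | smul c x hx ih =>
    obtain ⟨P, N, h⟩ := ih
    rcases le_total 0 c with hc | hc
    · refine ⟨P.map (fun u => c • u), N.map (fun u => c • u), fun v => ?_⟩
      rw [ContinuousMap.smul_apply, h, cbH_smul, cbH_smul, abs_of_nonneg hc, smul_eq_mul]; ring
    · refine ⟨N.map (fun u => c • u), P.map (fun u => c • u), fun v => ?_⟩
      rw [ContinuousMap.smul_apply, h, cbH_smul, cbH_smul, abs_of_nonpos hc, smul_eq_mul]; ring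

lemma cb_approx_of_even (hW : ∀ f : C(CbS, ℝ), (∀ v : CbS, f (-v) = f v) → f ∈ cbW)
    (L : Set CbE) (hL : IsCompact L) (hLc : Convex ℝ L) (hLn : L.Nonempty)
    (hs : ∀ x ∈ L, -x ∈ L) (ε : ℝ) (hε : 0 < ε) :
    ∃ P N : List CbE, L + cbZ N ⊆ cbZ P + cbZ (cbQ ε) ∧
      cbZ P ⊆ L + cbZ N + cbZ (cbQ ε) := by
  have hcont : Continuous fun v : CbS => sSup ((fun x => inner ℝ x (v : CbE)) '' L) :=
    hL.continuous_sSup (by fun_prop)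
  set f : C(CbS, ℝ) := ⟨_, hcont⟩ with hf
  have hfev : ∀ v : CbS, f (-v) = f v := by
    intro v
    simp only [hf, ContinuousMap.coe_mk]
    congr 1
    ext r
    constructor
    · rintro ⟨x, hx, rfl⟩; exact ⟨-x, hs x hx, by simp⟩
    · rintro ⟨x, hx, rfl⟩; exact ⟨-x, hs x hx, by simp⟩
  have hle : ∀ v : CbS, ∀ x ∈ L, inner ℝ x (v : CbE) ≤ f v := by
    intro v x hx
    exact le_csSup (hL.image (by fun_prop)).bddAbove ⟨x, hx, rfl⟩
  have hatt : ∀ v : CbS, ∃ x ∈ L, inner ℝ x (v : CbE) = f v := by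
    intro v
    obtain ⟨x, hx, h⟩ := (hL.image (f := fun x => inner ℝ x (v : CbE)) (by fun_prop)).sSup_mem (hLn.image _)
    exact ⟨x, hx, h⟩
  have hfW := hW f hfev
  rw [cbW, ← SetLike.mem_coe, Submodule.topologicalClosure_coe, Metric.mem_closure_iff] at hfW
  obtain ⟨g, hg, hfg⟩ := hfW ε hε
  obtain ⟨P, N, hPN⟩ := cb_span_lists g hg
  have hb : ∀ v : CbS, |f v - (cbH P v - cbH N v)| ≤ ε := by
    intro v
    rw [← hPN, ← Real.dist_eq]
    exact (ContinuousMap.dist_apply_le_dist v).trans hfg.le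
  refine ⟨P, N, ?_, ?_⟩
  · apply cb_subset
    · exact (cbZ_props _).1.add (cbZ_props _).1
    · exact (cbZ_props _).2.1.add (cbZ_props _).2.1
    · exact (cbZ_props _).2.2.add (cbZ_props _).2.2
    rintro v hv _ ⟨x, hx, z, hz, rfl⟩
    obtain ⟨p, hp, ep⟩ := cbZ_attain P v
    obtain ⟨q, hq, eq⟩ := cbZ_attain (cbQ ε) v
    refine ⟨p + q, add_mem_add hp hq, ?_⟩
    rw [inner_add_left, inner_add_left, ep, eq]
    have h1 := cbZ_le N v z hz
    have h2 := hle ⟨v, by simpa using hv⟩ x hx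
    have h3 := cbQ_ge ε hε.le v
    have h4 := (abs_le.mp (hb ⟨v, by simpa using hv⟩)).2
    simp only [hv] at *
    linarith
  · apply cb_subset
    · exact (hL.add (cbZ_props _).1).add (cbZ_props _).1
    · exact (hLc.add (cbZ_props _).2.1).add (cbZ_props _).2.1
    · exact (hLn.add (cbZ_props _).2.2).add (cbZ_props _).2.2
    rintro v hv z hz
    obtain ⟨p, hp, ep⟩ := cbZ_attain N v
    obtain ⟨q, hq, eq⟩ := cbZ_attain (cbQ ε) v
    obtain ⟨x, hx, ex⟩ := hatt ⟨v, by simpa using hv⟩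
    refine ⟨x + p + q, add_mem_add (add_mem_add hx hp) hq, ?_⟩
    simp only at ex
    rw [inner_add_left, inner_add_left, ep, eq, ex]
    have h1 := cbZ_le P v z hz
    have h3 := cbQ_ge ε hε.le v
    have h4 := (abs_le.mp (hb ⟨v, by simpa using hv⟩)).1
    simp only [hv] at *
    linarith
end CbC1

section CbC2
open MeasureTheory Set Filter Topology
open scoped ENNReal Pointwise

noncomputable def cbC (ι : Type) [Fintype ι] (z : EuclideanSpace ℝ ι) : ℝ :=
  ⨍ u in Metric.ball (0 : EuclideanSpace ℝ ι) 1, |inner ℝ u z|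

lemma cbC_iso (ι : Type) [Fintype ι] (z z' : EuclideanSpace ℝ ι) (h : ‖z‖ = ‖z'‖) : cbC ι z = cbC ι z' := by
  unfold cbC
  rw [setAverage_eq, setAverage_eq]
  congr 1
  set e : EuclideanSpace ℝ ι ≃ₗᵢ[ℝ] EuclideanSpace ℝ ι := ((ℝ ∙ (z - z'))ᗮ).reflection with he
  have ez : e z = z' := Submodule.reflection_sub h
  have mp : MeasurePreserving e volume volume := e.measurePreserving
  have hpre : e ⁻¹' (Metric.ball 0 1) = Metric.ball 0 1 := by
    ext x; simp
  have := mp.setIntegral_preimage_emb e.toHomeomorph.measurableEmbedding (fun u => |inner ℝ u z'|) (Metric.ball 0 1)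
  rw [← this, hpre]
  refine setIntegral_congr_fun measurableSet_ball fun u _ => ?_
  change |inner ℝ u z| = |inner ℝ (e u) z'|
  rw [← ez, e.inner_map_map]

lemma cbC_smul (ι : Type) [Fintype ι] (c : ℝ) (z : EuclideanSpace ℝ ι) : cbC ι (c • z) = |c| * cbC ι z := by
  unfold cbC
  rw [setAverage_eq, setAverage_eq]
  simp only [inner_smul_right, abs_mul, smul_eq_mul]
  rw [integral_const_mul]; ring

lemma cbC_ne (ι : Type) [Fintype ι] (z : EuclideanSpace ℝ ι) (hz : z ≠ 0) : cbC ι z ≠ 0 := by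
  intro h
  unfold cbC at h
  rw [setAverage_eq, smul_eq_mul, mul_eq_zero] at h
  rcases h with h | h
  · rw [inv_eq_zero, measureReal_eq_zero_iff measure_ball_lt_top.ne] at h
    exact (Metric.measure_ball_pos volume (0:EuclideanSpace ℝ ι) one_pos).ne' h
  · have hcont : Continuous fun u : EuclideanSpace ℝ ι => |inner ℝ u z| := by fun_prop
    rw [setIntegral_eq_zero_iff_of_nonneg_ae (Eventually.of_forall fun _ => abs_nonneg _)
      ((hcont.continuousOn.integrableOn_compact (isCompact_closedBall 0 1)).mono_set Metric.ball_subset_closedBall)] at h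
    have := Measure.eqOn_open_of_ae_eq h Metric.isOpen_ball hcont.continuousOn continuous_zero.continuousOn
    have h2 := this (x := ((2 * ‖z‖)⁻¹) • z) (by
      have := norm_pos_iff.mpr hz
      rw [mem_ball_zero_iff, norm_smul, Real.norm_eq_abs, abs_of_pos (by positivity)]
      field_simp; norm_num)
    simp [inner_smul_left, hz] at h2

noncomputable def cbSum {ι : Type} [Fintype ι] (w : ι → CbE) (u : EuclideanSpace ℝ ι) : CbE := ∑ i, u i • w i

lemma cb_sqrt_mem (ι : Type) [Fintype ι] (w : ι → CbE) (g : C(CbS, ℝ))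
    (hg : ∀ v : CbS, g v = √(∑ i, (inner ℝ (w i) (v : CbE)) ^ 2)) : g ∈ cbW := by
  classical
  by_cases hι : Nonempty ι
  swap
  · have : g = 0 := by
      ext v; rw [hg]; simp [not_nonempty_iff.mp hι]
    rw [this]; exact zero_mem _
  obtain ⟨i0⟩ := hι
  set G : C(EuclideanSpace ℝ ι × CbS, ℝ) := ⟨fun p => |inner ℝ (cbSum w p.1) (p.2 : CbE)|, by
    unfold cbSum; fun_prop⟩ with hG
  have hGc : Continuous G.curry := G.curry.continuous
  have hmem : ∀ u, G.curry u ∈ cbW := by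
    intro u
    apply Submodule.le_topologicalClosure
    apply Submodule.subset_span
    exact ⟨cbSum w u, by ext v; simp [cbPhi, hG]⟩
  have hint : IntegrableOn (fun u => G.curry u) (Metric.ball 0 1) volume :=
    (hGc.continuousOn.integrableOn_compact (isCompact_closedBall 0 1)).mono_set Metric.ball_subset_closedBall
  have hav : (⨍ u in Metric.ball (0:EuclideanSpace ℝ ι) 1, G.curry u) ∈ cbW := by
    have hc : IsClosed (cbW : Set C(CbS, ℝ)) := Submodule.isClosed_topologicalClosure _
    exact cbW.convex.set_average_mem hc (Metric.measure_ball_pos volume _ one_pos).ne'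
      measure_ball_lt_top.ne (Eventually.of_forall hmem) hint
  set e0 : EuclideanSpace ℝ ι := EuclideanSpace.single i0 1
  have he0 : ‖e0‖ = 1 := by simp [e0]
  have hC : cbC ι e0 ≠ 0 := cbC_ne ι e0 (by rw [← norm_ne_zero_iff, he0]; norm_num)
  have key : g = (cbC ι e0)⁻¹ • (⨍ u in Metric.ball (0:EuclideanSpace ℝ ι) 1, G.curry u) := by
    ext v
    have h1 : (⨍ u in Metric.ball (0:EuclideanSpace ℝ ι) 1, G.curry u) v
        = cbC ι (WithLp.toLp 2 fun i => inner ℝ (w i) (v : CbE)) := by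
      unfold cbC
      rw [setAverage_eq, setAverage_eq, ContinuousMap.smul_apply]
      congr 1
      have := (ContinuousMap.evalCLM ℝ v).integral_comp_comm hint
      rw [ContinuousMap.evalCLM_apply] at this
      rw [← this]
      refine setIntegral_congr_fun measurableSet_ball fun u _ => ?_
      simp only [ContinuousMap.evalCLM_apply, hG, ContinuousMap.curry_apply, ContinuousMap.coe_mk, cbSum, sum_inner,
        inner_smul_left, PiLp.inner_apply, conj_trivial]
      congr 1
      refine Finset.sum_congr rfl fun i _ => ?_
      simp [mul_comm]
    rw [ContinuousMap.smul_apply, h1, smul_eq_mul]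
    set z : EuclideanSpace ℝ ι := (WithLp.toLp 2 fun i => inner ℝ (w i) (v : CbE)) with hz
    rw [cbC_iso ι z (‖z‖ • e0) (by rw [norm_smul, he0]; simp), cbC_smul, abs_of_nonneg (norm_nonneg _), hg,
      EuclideanSpace.norm_eq]
    simp only [Real.norm_eq_abs, sq_abs, hz]
    field_simp
  rw [key]
  exact cbW.smul_mem _ hav
end CbC2

section CbC3
open MeasureTheory Set Filter Topology
open scoped ENNReal Pointwise

lemma cb_rho (s : ℝ) : ∃ ρ : ℝ → ℝ, ContinuousOn ρ (Ioi (-1)) ∧ ρ 0 = s ∧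
    ∀ y, (1 + y) ^ s = 1 + y * ρ y := by
  have hd : HasDerivAt (fun y : ℝ => (1 + y) ^ s) s 0 := by
    have := ((hasDerivAt_id (0:ℝ)).const_add 1).rpow_const (p := s) (Or.inl (by simp))
    simpa using this
  refine ⟨dslope (fun y : ℝ => (1 + y) ^ s) 0, ?_, ?_, ?_⟩
  · rw [continuousOn_dslope (Ioi_mem_nhds (by norm_num))]
    refine ⟨?_, hd.differentiableAt⟩
    apply ContinuousOn.rpow_const (by fun_prop)
    intro x hx
    left
    have : -1 < x := hx
    linarith
  · rw [dslope_same, hd.deriv]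
  · intro y
    have := sub_smul_dslope (fun y : ℝ => (1 + y) ^ s) 0 y
    simp only [sub_zero, smul_eq_mul, add_zero, Real.one_rpow] at this
    linarith

lemma cb_ind (l : List CbE) : ∀ (ι : Type) [Fintype ι] (w : ι → CbE)
    (_ : ∀ v : CbS, 0 < ∑ i, (inner ℝ (w i) (v : CbE)) ^ 2) (g : C(CbS, ℝ))
    (_ : ∀ v : CbS, g v = (∑ i, (inner ℝ (w i) (v : CbE)) ^ 2) ^ ((1:ℝ)/2 - l.length) *
      (l.map fun a => (inner ℝ a (v : CbE)) ^ 2).prod), g ∈ cbW := by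
  induction l with
  | nil =>
    intro ι _ w hq g hg
    refine cb_sqrt_mem ι w g fun v => ?_
    rw [hg, Real.sqrt_eq_rpow]; simp
  | cons a l ih =>
    intro ι _ w hq g hg
    set s : ℝ := 1/2 - l.length with hs
    have hs0 : s ≠ 0 := by
      intro h0
      have h1 : (2:ℝ) * l.length = 1 := by linarith
      have h2 : 2 * l.length = 1 := by exact_mod_cast h1
      omega
    obtain ⟨ρ, ρc, ρ0, hρ⟩ := cb_rho s
    set q : CbS → ℝ := fun v => ∑ i, (inner ℝ (w i) (v : CbE)) ^ 2 with hqd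
    set p : CbS → ℝ := fun v => (l.map fun a => (inner ℝ a (v : CbE)) ^ 2).prod with hp
    set r : CbS → ℝ := fun v => (inner ℝ a (v : CbE)) ^ 2 with hr
    have qc : Continuous q := by fun_prop
    have pc : Continuous p := by
      rw [hp]
      apply continuous_list_prod
      intro i _
      fun_prop
    have rc : Continuous r := by fun_prop
    have r0 : ∀ v, 0 ≤ r v := fun v => sq_nonneg _
    have hq' : ∀ v, 0 < q v := hq
    have hpow : ∀ c : ℝ, Continuous fun v => q v ^ c := fun c =>
      qc.rpow_const fun v => Or.inl (hq v).ne'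
    set G : C(ℝ × CbS, ℝ) := ⟨fun x => q x.2 ^ (s - 1) * r x.2 * p x.2 * ρ (|x.1| * r x.2 / q x.2), by
      have h1 : Continuous fun x : ℝ × CbS => q x.2 ^ (s-1) := (hpow (s-1)).comp continuous_snd
      have h2 : Continuous fun x : ℝ × CbS => ρ (|x.1| * r x.2 / q x.2) := by
        apply ρc.comp_continuous
        · apply Continuous.div
          · fun_prop
          · fun_prop
          · exact fun x => (hq x.2).ne'
        · intro x
          have : 0 ≤ |x.1| * r x.2 / q x.2 := by
            have := hq' x.2
            have := r0 x.2
            positivity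
          rw [mem_Ioi]; linarith
      exact ((h1.mul (rc.comp continuous_snd)).mul (pc.comp continuous_snd)).mul h2⟩ with hG
    have h0 : (⟨fun v => q v ^ s * p v, (hpow s).mul pc⟩ : C(CbS, ℝ)) ∈ cbW :=
      ih ι w hq _ fun v => rfl
    have ht : ∀ t : ℝ, 0 < t → G.curry t ∈ cbW := by
      intro t ht
      have hqt : ∀ v, 0 < q v + t * r v := fun v => by
        have := hq' v
        have := r0 v
        positivity
      have hsum : ∀ v : CbS, ∑ i : Option ι, (inner ℝ ((fun o : Option ι => o.elim (√t • a) w) i) (v : CbE)) ^ 2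
          = q v + t * r v := by
        intro v
        rw [Fintype.sum_option]
        simp only [Option.elim_none, Option.elim_some, inner_smul_left, conj_trivial, mul_pow, Real.sq_sqrt ht.le]
        rw [add_comm]
      have h1 : (⟨fun v => (q v + t * r v) ^ s * p v,
          ((qc.add (continuous_const.mul rc)).rpow_const fun v => Or.inl (hqt v).ne').mul pc⟩ : C(CbS, ℝ)) ∈ cbW := by
        refine ih (Option ι) (fun o => o.elim (√t • a) w) (fun v => ?_) _ fun v => ?_
        · rw [hsum]; exact hqt v
        · rw [hsum]; rfl
      have : G.curry t = t⁻¹ • ((⟨fun v => (q v + t * r v) ^ s * p v,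
          ((qc.add (continuous_const.mul rc)).rpow_const fun v => Or.inl (hqt v).ne').mul pc⟩ : C(CbS, ℝ)) -
          (⟨fun v => q v ^ s * p v, (hpow s).mul pc⟩ : C(CbS, ℝ))) := by
        ext v
        simp only [hG, ContinuousMap.curry_apply, ContinuousMap.coe_mk, ContinuousMap.smul_apply,
          ContinuousMap.sub_apply, smul_eq_mul, abs_of_pos ht]
        have hv := hq' v
        have e1 : q v + t * r v = q v * (1 + t * r v / q v) := by field_simp
        have : 0 ≤ t * r v / q v := by
          have := r0 v
          positivity
        rw [e1, Real.mul_rpow hv.le (by linarith), hρ, Real.rpow_sub_one hv.ne']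
        field_simp
        ring
      rw [this]
      exact cbW.smul_mem _ (cbW.sub_mem h1 h0)
    have hc : IsClosed (cbW : Set C(CbS, ℝ)) := Submodule.isClosed_topologicalClosure _
    have hG0 : G.curry 0 ∈ cbW := by
      have hl : Tendsto (fun t : ℝ => G.curry t) (𝓝[>] 0) (𝓝 (G.curry 0)) :=
        (G.curry.continuous.tendsto 0).mono_left nhdsWithin_le_nhds
      exact hc.mem_of_tendsto hl (eventually_mem_nhdsWithin.mono fun t h => ht t h)
    have : g = s⁻¹ • G.curry 0 := by
      ext v
      rw [hg]
      simp only [hG, ContinuousMap.curry_apply, ContinuousMap.coe_mk, ContinuousMap.smul_apply, abs_zero, zero_mul,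
        zero_div, ρ0, smul_eq_mul, List.map_cons, List.prod_cons, List.length_cons]
      have e : (1:ℝ)/2 - ((l.length + 1 : ℕ) : ℝ) = s - 1 := by push_cast; rw [hs]; ring
      rw [e]
      change q v ^ (s-1) * (r v * p v) = _
      field_simp
    rw [this]
    exact cbW.smul_mem _ hG0

lemma cb_prod_mem (l : List CbE) (g : C(CbS, ℝ))
    (hg : ∀ v : CbS, g v = (l.map fun a => (inner ℝ a (v : CbE)) ^ 2).prod) : g ∈ cbW := by
  have key : ∀ v : CbS, ∑ i : Fin 3, (inner ℝ (EuclideanSpace.single i (1:ℝ)) (v : CbE)) ^ 2 = 1 := by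
    intro v
    have h : ‖(v : CbE)‖ = 1 := by simpa using v.2
    have h2 : ‖(v : CbE)‖ ^ 2 = 1 := by rw [h]; norm_num
    rw [EuclideanSpace.norm_sq_eq] at h2
    simpa [EuclideanSpace.inner_single_left] using h2
  refine cb_ind l (Fin 3) (fun i => EuclideanSpace.single i 1) (fun v => ?_) g fun v => ?_
  · rw [key]; norm_num
  · rw [key, hg]; simp

noncomputable def cbSq (a : CbE) : C(CbS, ℝ) := ⟨fun v => (inner ℝ a (v : CbE)) ^ 2, by fun_prop⟩

lemma cb_adjoin_le : (Subalgebra.toSubmodule (Algebra.adjoin ℝ (range cbSq))) ≤ cbW := by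
  rw [Algebra.adjoin_eq_span]
  rw [Submodule.span_le]
  intro g hg
  obtain ⟨l, hl, rfl⟩ := Submonoid.exists_list_of_mem_closure hg
  have : ∃ l' : List CbE, l = l'.map cbSq := by
    clear hg
    induction l with
    | nil => exact ⟨[], rfl⟩
    | cons x l ih =>
      obtain ⟨l', rfl⟩ := ih fun y hy => hl y (List.mem_cons_of_mem _ hy)
      obtain ⟨a, rfl⟩ := hl x List.mem_cons_self
      exact ⟨a :: l', rfl⟩
  obtain ⟨l', rfl⟩ := this
  refine cb_prod_mem l' _ fun v => ?_
  clear hg hl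
  induction l' with
  | nil => simp
  | cons a l ih => simp only [List.map_cons, List.prod_cons, ContinuousMap.mul_apply, ih]; rfl

lemma cb_even_mem (f : C(CbS, ℝ)) (hf : ∀ v : CbS, f (-v) = f v) : f ∈ cbW := by
  -- quotient
  set m : CbS → (CbE → ℝ) := fun v a => (inner ℝ a (v : CbE)) ^ 2 with hm
  have mc : Continuous m := by
    apply continuous_pi; intro a; fun_prop
  have hmm : ∀ v v' : CbS, m v = m v' → f v = f v' := by
    intro v v' h
    have h1 := congrFun h (v : CbE)
    have n1 : ‖(v : CbE)‖ = 1 := by simpa using v.2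
    have n2 : ‖(v' : CbE)‖ = 1 := by simpa using v'.2
    simp only [hm, real_inner_self_eq_norm_sq, n1] at h1
    have h2 : inner ℝ (v : CbE) (v' : CbE) = 1 ∨ inner ℝ (v : CbE) (v' : CbE) = -1 := by
      have h3 : (inner ℝ (v : CbE) (v' : CbE) - 1) * (inner ℝ (v : CbE) (v' : CbE) + 1) = 0 := by
        linear_combination -h1
      rcases mul_eq_zero.mp h3 with h | h
      · left; linarith
      · right; linarith
    rcases h2 with h2 | h2
    · rw [inner_eq_one_iff_of_norm_eq_one n1 n2] at h2
      rw [Subtype.ext h2]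
    · rw [inner_eq_neg_one_iff_of_norm_eq_one n1 n2] at h2
      rw [← hf v']
      congr 1
      exact Subtype.ext h2
  set X : Set (CbE → ℝ) := range m
  have : CompactSpace X := isCompact_iff_compactSpace.mp (isCompact_range mc)
  set π : C(CbS, X) := ⟨rangeFactorization m, by exact mc.subtype_mk _⟩ with hπ
  have πs : Function.Surjective π := rangeFactorization_surjective
  have πq : IsQuotientMap π := IsQuotientMap.of_surjective_continuous πs π.continuous
  set f' : C(X, ℝ) := πq.lift f (fun a b h => hmm a b (congrArg Subtype.val h)) with hf'
  have hff : f'.comp π = f := πq.lift_comp f _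
  set A : Subalgebra ℝ C(X, ℝ) := (Algebra.adjoin ℝ (range cbSq)).comap (ContinuousMap.compRightAlgHom ℝ ℝ π) with hA
  have hsep : A.SeparatesPoints := by
    intro x y hxy
    have : ∃ a, x.1 a ≠ y.1 a := by
      by_contra! h
      exact hxy (Subtype.ext (funext h))
    obtain ⟨a, ha⟩ := this
    refine ⟨_, ⟨⟨fun x : X => x.1 a, (continuous_apply a).comp continuous_subtype_val⟩, ?_, rfl⟩, ha⟩
    have : (ContinuousMap.compRightAlgHom ℝ ℝ π) ⟨fun x : X => x.1 a, (continuous_apply a).comp continuous_subtype_val⟩ = cbSq a := by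
      ext v; rfl
    exact (congrArg (fun z => z ∈ Algebra.adjoin ℝ (range cbSq)) this).mpr (Algebra.subset_adjoin ⟨a, rfl⟩)
  have htop := ContinuousMap.subalgebra_topologicalClosure_eq_top_of_separatesPoints A hsep
  have hcl : f' ∈ closure (A : Set C(X, ℝ)) := by
    have : f' ∈ A.topologicalClosure := by rw [htop]; trivial
    rwa [← SetLike.mem_coe, Subalgebra.topologicalClosure_coe] at this
  have hc : IsClosed (cbW : Set C(CbS, ℝ)) := Submodule.isClosed_topologicalClosure _
  rw [← hff]
  have hcomp : Continuous fun g : C(X, ℝ) => g.comp π := ContinuousMap.continuous_precomp π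
  have hpc : IsClosed ((fun g : C(X, ℝ) => g.comp π) ⁻¹' (cbW : Set C(CbS, ℝ))) := hc.preimage hcomp
  have hsub : (A : Set C(X, ℝ)) ⊆ (fun g : C(X, ℝ) => g.comp π) ⁻¹' (cbW : Set C(CbS, ℝ)) :=
    fun g hg => cb_adjoin_le hg
  exact closure_minimal hsub hpc hcl
end CbC3

section CbF1
open MeasureTheory Set Filter Topology
open scoped ENNReal Pointwise

lemma cbVol_smul (t : ℝ) (ht : 0 ≤ t) (X : Set CbE) : cbVol (t • X) = t ^ 3 * cbVol X := by
  unfold cbVol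
  rw [Measure.addHaar_smul]
  have : Module.finrank ℝ CbE = 3 := by simp
  rw [this, abs_of_nonneg (by positivity), ENNReal.toReal_mul, ENNReal.toReal_ofReal (by positivity)]

lemma cb_mix (X L : Set CbE) (hX : IsCompact X) (hc : Convex ℝ X) (hL : IsCompact L) (hLc : Convex ℝ L)
    (hLn : L.Nonempty) (hs : ∀ x ∈ L, -x ∈ L) (b : ℝ) (hbX : CbBr X b) (hbL : CbBr L b) :
    Tendsto (fun s : ℝ => (cbVol (X + s • L) - cbVol X) / s) (𝓝[>] 0) (𝓝 (3 * cbVol L)) := by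
  refine cb_mixed L hL hLc hLn (fun ε hε => cb_approx_of_even cb_even_mem L hL hLc hLn hs ε hε)
    X L b hX hc hbX hL hLc hbL _ ?_
  have h1 : Tendsto (fun s : ℝ => (3 + 3 * s + s ^ 2) * cbVol L) (𝓝[>] 0) (𝓝 (3 * cbVol L)) := by
    have : Continuous fun s : ℝ => (3 + 3 * s + s ^ 2) * cbVol L := by fun_prop
    have := (this.tendsto 0).mono_left (nhdsWithin_le_nhds (s := Ioi 0))
    simpa using this
  refine h1.congr' ?_
  filter_upwards [self_mem_nhdsWithin] with s hs
  have hs : 0 < s := hs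
  have e : L + s • L = (1 + s) • L := by
    rw [hLc.add_smul zero_le_one hs.le, one_smul]
  rw [e, cbVol_smul _ (by positivity)]
  field_simp
  ring

lemma cb_PL_V (u : CbE) (hu : ‖u‖ = 1) : CbPL (CbV u) volume := by
  have h1 : CbPL (ℝ × ℝ) volume := cb_PL_prod ℝ volume cb_PL_real
  have h2 : CbPL (EuclideanSpace ℝ (Fin 2)) volume := by
    refine cb_PL_map _ _ _ _ h1
      ((WithLp.linearEquiv 2 ℝ (Fin 2 → ℝ)).symm.toLinearMap ∘ₗ (LinearEquiv.finTwoArrow ℝ ℝ).symm.toLinearMap) ?_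
    have a := (MeasureTheory.volume_preserving_finTwoArrow ℝ).symm
    have b := EuclideanSpace.volume_preserving_symm_measurableEquiv_toLp (Fin 2)
    exact (b.symm).comp a
  set e := ((stdOrthonormalBasis ℝ (CbV u)).reindex (finCongr (cbV_finrank u hu))).repr.symm
  exact cb_PL_map _ _ _ _ h2 e.toLinearEquiv.toLinearMap e.measurePreserving

lemma cb_PL_E : CbPL CbE volume := by
  have hu : ‖(EuclideanSpace.single 0 1 : CbE)‖ = 1 := by simp
  exact cb_PL_map _ _ _ _ (cb_PL_prod _ _ (cb_PL_V _ hu)) (cbPsi _) (cbPsi_mp _ hu)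

lemma cb_BM (X Y : Set CbE) (hX : IsCompact X) (hY : IsCompact Y) (a b : ℝ) (ha : 0 < a) (hb : 0 < b) (hab : a + b = 1)
    : cbVol X ^ a * cbVol Y ^ b ≤ cbVol (a • X + b • Y) := by
  have h := cb_PL_set CbE volume cb_PL_E a b ha hb hab X Y (a • X + b • Y) hX.measurableSet hY.measurableSet
    ((hX.smul a).add (hY.smul b)).measurableSet
    (fun x hx y hy => add_mem_add (smul_mem_smul_set hx) (smul_mem_smul_set hy))
  have := ENNReal.toReal_mono ((hX.smul a).add (hY.smul b)).measure_lt_top.ne h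
  rwa [ENNReal.toReal_mul, ← ENNReal.toReal_rpow, ← ENNReal.toReal_rpow] at this

lemma cb_BM3 (X Y : Set CbE) (hX : IsCompact X) (hY : IsCompact Y) (hp : 0 < cbVol X) (s t : ℝ) (hs : 0 < s)
    (ht : 0 < t) (h : cbVol Y = s ^ 3 * cbVol X) : (1 + t * s) ^ 3 * cbVol X ≤ cbVol (X + t • Y) := by
  have hD : 0 < 1 + t * s := by positivity
  have h1 := cb_BM X (s⁻¹ • Y) hX (hY.smul _) (1 / (1 + t * s)) (t * s / (1 + t * s)) (by positivity) (by positivity)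
    (by field_simp)
  have e : cbVol (s⁻¹ • Y) = cbVol X := by
    rw [cbVol_smul _ (by positivity), h]; field_simp
  rw [e, ← Real.rpow_add hp, ← add_div, div_self hD.ne', Real.rpow_one] at h1
  have e2 : X + t • Y = (1 + t * s) • ((1 / (1 + t * s)) • X + (t * s / (1 + t * s)) • s⁻¹ • Y) := by
    rw [smul_add, smul_smul, smul_smul, smul_smul]
    congr 1
    · rw [mul_one_div_cancel hD.ne', one_smul]
    · congr 1
      field_simp
  rw [e2, cbVol_smul _ hD.le]
  gcongr

lemma cb_vol_le (X L : Set CbE) (hX : IsCompact X) (hL : IsCompact L)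
    (hp : 0 < cbVol X) (hpL : 0 < cbVol L)
    (hlim : Tendsto (fun s : ℝ => (cbVol (X + s • L) - cbVol X) / s) (𝓝[>] 0) (𝓝 (3 * cbVol L))) :
    cbVol X ≤ cbVol L := by
  set s : ℝ := (cbVol L / cbVol X) ^ ((1:ℝ)/3) with hs
  have hs0 : 0 < s := by positivity
  have hs3 : s ^ 3 = cbVol L / cbVol X := by
    rw [hs, ← Real.rpow_natCast, ← Real.rpow_mul (by positivity)]; norm_num
  have e : cbVol L = s ^ 3 * cbVol X := by rw [hs3]; field_simp
  have h1 : 3 * s * cbVol X ≤ 3 * cbVol L := by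
    refine ge_of_tendsto hlim ?_
    filter_upwards [self_mem_nhdsWithin] with t ht
    have ht : 0 < t := ht
    have := cb_BM3 X L hX hL hp s t hs0 ht e
    rw [le_div_iff₀ ht]
    have h2 : 0 ≤ (3 * t ^ 2 * s ^ 2 + t ^ 3 * s ^ 3) * cbVol X := by positivity
    nlinarith
  have h2 : s ≤ s ^ 3 := by
    have : s * cbVol X ≤ s ^ 3 * cbVol X := by linarith
    exact le_of_mul_le_mul_right this hp
  have h3 : 1 ≤ s := by
    by_contra! h
    have : s ^ 3 < s := by
      have : s ^ 2 < 1 := by nlinarith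
      nlinarith
    linarith
  rw [e]
  have : 1 ≤ s ^ 3 := one_le_pow₀ h3
  nlinarith
end CbF1

section CbF2
open MeasureTheory Set Filter Topology
open scoped ENNReal Pointwise

/-- Local inverse of the cumulative function. -/
lemma cb_inv (r β : ℝ) (hr : 0 < r) (g G : ℝ → ℝ) (hg : ∀ y ∈ Ioo (-r) r, 0 < g y)
    (hG : ∀ y ∈ Ioo (-r) r, HasDerivAt G (g y) y) (hGc : ContinuousOn G (Icc (-r) r))
    (hG0 : G (-r) = 0) (hG1 : G r = β) :
    ∃ H : ℝ → ℝ, StrictMonoOn H (Ioo 0 β) ∧ ∀ c ∈ Ioo 0 β, H c ∈ Ioo (-r) r ∧ HasDerivAt H (g (H c))⁻¹ c := by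
  have hmono : StrictMonoOn G (Icc (-r) r) := by
    apply strictMonoOn_of_deriv_pos (convex_Icc _ _) hGc
    intro x hx
    rw [interior_Icc] at hx
    rw [(hG x hx).deriv]; exact hg x hx
  have hex : ∀ c : ℝ, ∃ y, c ∈ Ioo 0 β → y ∈ Ioo (-r) r ∧ G y = c := by
    intro c
    by_cases hc : c ∈ Ioo 0 β
    · have := intermediate_value_Ioo (by linarith : -r ≤ r) hGc
      rw [hG0, hG1] at this
      obtain ⟨y, hy, e⟩ := this hc
      exact ⟨y, fun _ => ⟨hy, e⟩⟩
    · exact ⟨0, fun h => absurd h hc⟩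
  choose H hH using hex
  have Hmono : StrictMonoOn H (Ioo 0 β) := by
    intro a ha b hb hab
    by_contra! h
    have := hmono.monotoneOn (Ioo_subset_Icc_self (hH b hb).1) (Ioo_subset_Icc_self (hH a ha).1) h
    rw [(hH a ha).2, (hH b hb).2] at this
    linarith
  refine ⟨H, Hmono, fun c hc => ⟨(hH c hc).1, ?_⟩⟩
  have himg : H '' Ioo 0 β = Ioo (-r) r := by
    apply Subset.antisymm
    · rintro _ ⟨a, ha, rfl⟩; exact (hH a ha).1
    · intro y hy
      have hGy : G y ∈ Ioo 0 β := by
        rw [← hG0, ← hG1]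
        exact ⟨hmono (left_mem_Icc.mpr (by linarith)) (Ioo_subset_Icc_self hy) hy.1,
          hmono (Ioo_subset_Icc_self hy) (right_mem_Icc.mpr (by linarith)) hy.2⟩
      refine ⟨G y, hGy, ?_⟩
      exact hmono.injOn (Ioo_subset_Icc_self (hH _ hGy).1) (Ioo_subset_Icc_self hy) (hH _ hGy).2
  have hcont : ContinuousAt H c := by
    apply Hmono.continuousAt_of_image_mem_nhds (Ioo_mem_nhds hc.1 hc.2)
    rw [himg]
    exact Ioo_mem_nhds (hH c hc).1.1 (hH c hc).1.2
  refine HasDerivAt.of_local_left_inverse hcont (hG _ (hH c hc).1) (hg _ (hH c hc).1).ne' ?_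
  filter_upwards [Ioo_mem_nhds hc.1 hc.2] with z hz using (hH z hz).2

lemma cb_cum (f : ℝ → ℝ) (hf : Integrable f) :
    ∀ᵐ x, HasDerivAt (fun x => ∫ t in Iic x, f t) (f x) x := by
  have h := LocallyIntegrable.ae_hasDerivAt_integral hf.locallyIntegrable
  filter_upwards [h] with x hx
  have h1 := (hx 0).const_add (∫ t in Iic 0, f t)
  refine h1.congr_of_eventuallyEq (Eventually.of_forall fun y => ?_)
  have := intervalIntegral.integral_Iic_sub_Iic (hf.integrableOn (s := Iic 0)) (hf.integrableOn (s := Iic y))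
  simp only
  linarith

lemma cb_right_pos (f : ℝ → ℝ) (d x : ℝ) (hd : 0 < d) (h : HasDerivAt f d x) (y : ℝ) (hy : x < y) :
    ∃ z ∈ Ioo x y, f x < f z := by
  have h1 := ((tendsto_sup.mp ((nhdsLT_sup_nhdsGT x).symm ▸ hasDerivAt_iff_tendsto_slope.mp h))).2
  have h2 : ∀ᶠ z in 𝓝[>] x, 0 < slope f x z := h1.eventually_const_lt hd
  obtain ⟨z, hz, hz2⟩ := (h2.and (Ioo_mem_nhdsGT hy)).exists
  refine ⟨z, hz2, ?_⟩
  rw [slope_def_field, div_pos_iff_of_pos_right (by linarith [hz2.1])] at hz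
  linarith

lemma cb_left_pos (f : ℝ → ℝ) (d x : ℝ) (hd : 0 < d) (h : HasDerivAt f d x) :
    ∃ z, z < x ∧ f z < f x := by
  have h1 := ((tendsto_sup.mp ((nhdsLT_sup_nhdsGT x).symm ▸ hasDerivAt_iff_tendsto_slope.mp h))).1
  have h2 : ∀ᶠ z in 𝓝[<] x, 0 < slope f x z := h1.eventually_const_lt hd
  obtain ⟨z, hz, hz2⟩ := (h2.and self_mem_nhdsWithin).exists
  have hz2 : z < x := hz2
  refine ⟨z, hz2, ?_⟩
  rw [slope_def_field] at hz
  by_contra! hcon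
  have : (f z - f x) / (z - x) ≤ 0 := div_nonpos_of_nonneg_of_nonpos (by linarith) (by linarith)
  linarith

lemma cb_transport (f g G : ℝ → ℝ) (F : ℝ → ℝ≥0∞) (r β : ℝ) (hr : 0 < r)
    (hfm : Measurable f) (hgm : Measurable g) (hf : Integrable f) (hf0 : ∀ x, 0 ≤ f x)
    (hfβ : ∫ x, f x = β) (hg : ∀ y ∈ Ioo (-r) r, 0 < g y)
    (hG : ∀ y ∈ Ioo (-r) r, HasDerivAt G (g y) y) (hGc : ContinuousOn G (Icc (-r) r))
    (hG0 : G (-r) = 0) (hG1 : G r = β)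
    (hF : ∀ x y, ENNReal.ofReal √(f x * g y) ≤ F ((x + y) / 2))
    (hFβ : ∫⁻ x, F x ≤ ENNReal.ofReal β) : volume {x | 0 < f x} ≤ ENNReal.ofReal (2 * r) := by
  obtain ⟨H, Hmono, hH⟩ := cb_inv r β hr g G hg hG hGc hG0 hG1
  set Fc : ℝ → ℝ := fun x => ∫ t in Iic x, f t with hFc
  have hcum : ∀ᵐ x, HasDerivAt Fc (f x) x := cb_cum f hf
  set N := toMeasurable volume {x | ¬ HasDerivAt Fc (f x) x} with hN
  have hN0 : volume N = 0 := by rw [hN, measure_toMeasurable]; exact hcum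
  set P : Set ℝ := {x | 0 < f x} with hP
  have hPm : MeasurableSet P := measurableSet_lt measurable_const hfm
  set S : Set ℝ := P \ N with hS
  have hSm : MeasurableSet S := hPm.diff (measurableSet_toMeasurable _ _)
  have hSP : S =ᵐ[volume] P := sdiff_null_ae_eq_self hN0
  have hSf : ∀ x ∈ S, 0 < f x := fun x hx => hx.1
  have hSd : ∀ x ∈ S, HasDerivAt Fc (f x) x := by
    intro x hx
    by_contra h
    exact hx.2 (subset_toMeasurable _ _ h)
  have Fcmono : Monotone Fc := by
    intro a b hab
    exact setIntegral_mono_set hf.integrableOn (Eventually.of_forall hf0) (Iic_subset_Iic.mpr hab).eventuallyLE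
  have Fc0 : ∀ x, 0 ≤ Fc x := fun x => integral_nonneg hf0
  have Fc1 : ∀ x, Fc x ≤ β := by
    intro x; rw [← hfβ]; exact setIntegral_le_integral hf (Eventually.of_forall hf0)
  have hSc : ∀ x ∈ S, Fc x ∈ Ioo 0 β := by
    intro x hx
    obtain ⟨z, _, hz⟩ := cb_left_pos Fc _ x (hSf x hx) (hSd x hx)
    obtain ⟨z', _, hz'⟩ := cb_right_pos Fc _ x (hSf x hx) (hSd x hx) (x+1) (by linarith)
    exact ⟨(Fc0 z).trans_lt hz, hz'.trans_le (Fc1 z')⟩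
  have FcS : StrictMonoOn Fc S := by
    intro x hx y hy hxy
    obtain ⟨z', hz, hz'⟩ := cb_right_pos Fc _ x (hSf x hx) (hSd x hx) y hxy
    exact hz'.trans_le (Fcmono hz.2.le)
  set T : ℝ → ℝ := fun x => H (Fc x) with hT
  have TS : StrictMonoOn T S := by
    intro x hx y hy hxy
    exact Hmono (hSc x hx) (hSc y hy) (FcS hx hy hxy)
  set τ : ℝ → ℝ := fun x => f x / g (T x) with hτ
  have hTr : ∀ x ∈ S, T x ∈ Ioo (-r) r := fun x hx => (hH _ (hSc x hx)).1
  have hTd : ∀ x ∈ S, HasDerivAt T (τ x) x := by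
    intro x hx
    have := (hH _ (hSc x hx)).2.comp x (hSd x hx)
    refine this.congr_deriv ?_
    rw [hτ]; simp only [hT]; ring
  have hgT : ∀ x ∈ S, 0 < g (T x) := fun x hx => hg _ (hTr x hx)
  have hτp : ∀ x ∈ S, 0 < τ x := fun x hx => div_pos (hSf x hx) (hgT x hx)
  have hTm : AEMeasurable T (volume.restrict S) :=
    ContinuousOn.aemeasurable (fun x hx => (hTd x hx).continuousAt.continuousWithinAt) hSm
  have hτm : AEMeasurable τ (volume.restrict S) := hfm.aemeasurable.div (hgm.comp_aemeasurable hTm)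
  -- change of variables with midpoint
  set M : ℝ → ℝ := fun x => (x + T x) / 2 with hM
  have hMd : ∀ x ∈ S, HasDerivWithinAt M ((1 + τ x) / 2) S x := fun x hx =>
    (((hasDerivAt_id x).add (hTd x hx)).div_const 2).hasDerivWithinAt
  have hMi : InjOn M S := by
    apply StrictMonoOn.injOn
    intro x hx y hy hxy
    have := TS hx hy hxy
    simp only [hM]; linarith
  have hcv := lintegral_image_eq_lintegral_abs_deriv_mul hSm hMd hMi F
  set h : ℝ → ℝ := fun x => f x * ((1 + τ x) / (2 * √(τ x))) with hh
  have hge : ∀ x ∈ S, ENNReal.ofReal (h x) ≤ ENNReal.ofReal |(1 + τ x) / 2| * F (M x) := by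
    intro x hx
    refine le_trans ?_ (mul_le_mul_right (hF x (T x)) _)
    rw [← ENNReal.ofReal_mul (abs_nonneg _)]
    apply ENNReal.ofReal_le_ofReal
    have h1 := hSf x hx
    have h2 := hgT x hx
    have h3 := hτp x hx
    rw [abs_of_pos (by positivity)]
    have e : f x * g (T x) = f x ^ 2 / τ x := by
      simp only [hτ]; field_simp
    rw [e, Real.sqrt_div (by positivity), Real.sqrt_sq h1.le]
    simp only [hh]
    apply le_of_eq
    field_simp
  have hle : ∀ x ∈ S, f x ≤ h x := by
    intro x hx
    have h1 := hSf x hx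
    have h3 := hτp x hx
    have h4 := Real.sqrt_pos.mpr h3
    have : 1 ≤ (1 + τ x) / (2 * √(τ x)) := by
      rw [le_div_iff₀ (by positivity)]
      nlinarith [sq_nonneg (√(τ x) - 1), Real.sq_sqrt h3.le]
    exact le_mul_of_one_le_right h1.le this
  have hfl : ∫⁻ x in S, ENNReal.ofReal (f x) = ENNReal.ofReal β := by
    rw [← hfβ, ofReal_integral_eq_lintegral_ofReal hf (Eventually.of_forall hf0),
      setLIntegral_congr hSP]
    rw [← lintegral_indicator hPm]
    apply lintegral_congr
    intro x
    by_cases hx : 0 < f x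
    · rw [indicator_of_mem (show x ∈ P from hx)]
    · rw [indicator_of_notMem (show x ∉ P from hx), ENNReal.ofReal_of_nonpos (not_lt.mp hx)]
  have hhl : ∫⁻ x in S, ENNReal.ofReal (h x) ≤ ∫⁻ x in S, ENNReal.ofReal (f x) := by
    calc ∫⁻ x in S, ENNReal.ofReal (h x) ≤ ∫⁻ x in S, ENNReal.ofReal |(1 + τ x) / 2| * F (M x) :=
          setLIntegral_mono' hSm hge
      _ = ∫⁻ x in M '' S, F x := hcv.symm
      _ ≤ ∫⁻ x, F x := setLIntegral_le_lintegral _ _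
      _ ≤ _ := by rw [hfl]; exact hFβ
  have hhm : AEMeasurable (fun x => ENNReal.ofReal (h x)) (volume.restrict S) := by
    apply AEMeasurable.ennreal_ofReal
    exact hfm.aemeasurable.mul ((hτm.const_add 1).div (hτm.sqrt.const_mul 2))
  have hae : (fun x => ENNReal.ofReal (f x)) =ᵐ[volume.restrict S] fun x => ENNReal.ofReal (h x) := by
    apply ae_eq_of_ae_le_of_lintegral_le _ _ hhm hhl
    · rw [EventuallyLE, ae_restrict_iff' hSm]
      exact Eventually.of_forall fun x hx => ENNReal.ofReal_le_ofReal (hle x hx)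
    · rw [hfl]; exact ENNReal.ofReal_ne_top
  have hτ1 : ∀ᵐ x ∂(volume.restrict S), ENNReal.ofReal |τ x| = 1 := by
    rw [EventuallyEq, ae_restrict_iff' hSm] at hae
    rw [ae_restrict_iff' hSm]
    filter_upwards [hae] with x hx hxS
    have h1 := hSf x hxS
    have h3 := hτp x hxS
    have h4 := Real.sqrt_pos.mpr h3
    have e := (ENNReal.ofReal_eq_ofReal_iff h1.le (h1.le.trans (hle x hxS))).mp (hx hxS)
    simp only [hh] at e
    have e2 : (1 + τ x) / (2 * √(τ x)) = 1 := by
      have : f x * ((1 + τ x) / (2 * √(τ x))) = f x * 1 := by rw [← e, mul_one]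
      exact mul_left_cancel₀ h1.ne' this
    rw [div_eq_one_iff_eq (by positivity)] at e2
    have e3 : (√(τ x) - 1) ^ 2 = 0 := by nlinarith [Real.sq_sqrt h3.le]
    have e4 : √(τ x) = 1 := by have := pow_eq_zero_iff (two_ne_zero) |>.mp e3; linarith
    have e5 : τ x = 1 := by rw [← Real.sq_sqrt h3.le, e4]; norm_num
    rw [e5]; simp
  have hcv2 := lintegral_image_eq_lintegral_abs_deriv_mul hSm (fun x hx => (hTd x hx).hasDerivWithinAt) TS.injOn
    (fun _ => 1)
  calc volume P = volume S := (measure_congr hSP).symm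
    _ = ∫⁻ x in S, 1 := by simp
    _ = ∫⁻ x in S, ENNReal.ofReal |τ x| * 1 := by
        apply lintegral_congr_ae
        filter_upwards [hτ1] with x hx
        rw [hx, mul_one]
    _ = volume (T '' S) := by rw [← hcv2]; simp
    _ ≤ volume (Ioo (-r) r) := measure_mono (by rintro _ ⟨x, hx, rfl⟩; exact hTr x hx)
    _ = ENNReal.ofReal (2 * r) := by rw [Real.volume_Ioo]; congr 1; ring
end CbF2

section CbF3
open MeasureTheory Set Filter Topology
open scoped ENNReal Pointwise

lemma cb_half (K B : Set CbE) (hK : IsCompact K) (hB : IsCompact B) (hKc : Convex ℝ K)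
    (hp : 0 < cbVol K) (hpB : 0 < cbVol B) (he : cbVol K = cbVol B)
    (hlim : Tendsto (fun s : ℝ => (cbVol (K + s • B) - cbVol K) / s) (𝓝[>] 0) (𝓝 (3 * cbVol B))) :
    cbVol ((1/2:ℝ) • K + (1/2:ℝ) • B) ≤ cbVol K := by
  set M := (1/2:ℝ) • K + (1/2:ℝ) • B with hM
  have hMc : IsCompact M := (hK.smul _).add (hB.smul _)
  set β := cbVol K with hβ
  have hMp : 0 < cbVol M := by
    have := cb_BM K B hK hB (1/2) (1/2) (by norm_num) (by norm_num) (by norm_num)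
    exact lt_of_lt_of_le (by positivity) this
  set l := Real.log (cbVol M / β) with hl
  have key : ∀ s : ℝ, 0 < s → s < 1 → (3 + 3 * s + s ^ 2 + 2 * (1 + s) ^ 2 * l) * β ≤ (cbVol (K + s • B) - β) / s := by
    intro s hs hs1
    have hD : 0 < 1 + s := by linarith
    have h1 := cb_BM K M hK hMc ((1 - s) / (1 + s)) (2 * s / (1 + s)) (div_pos (by linarith) hD) (by positivity)
      (by field_simp; ring)
    have e : ((1 - s) / (1 + s)) • K + (2 * s / (1 + s)) • M = (1 + s)⁻¹ • (K + s • B) := by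
      rw [hM, smul_add, smul_add, ← add_assoc, smul_smul, smul_smul, smul_smul,
        ← hKc.add_smul (div_nonneg (by linarith) hD.le) (by positivity)]
      congr 2 <;> field_simp
      ring
    rw [e, cbVol_smul _ (by positivity)] at h1
    have e2 : β ^ ((1 - s) / (1 + s)) * cbVol M ^ (2 * s / (1 + s)) = β * Real.exp (2 * s / (1 + s) * l) := by
      rw [hl, mul_comm _ (Real.log _), ← Real.rpow_def_of_pos (by positivity), Real.div_rpow hMp.le hp.le]
      have : (1 - s) / (1 + s) = 1 - 2 * s / (1 + s) := by field_simp; ring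
      rw [this, Real.rpow_sub hp, Real.rpow_one]
      ring
    rw [e2] at h1
    have h3 := Real.add_one_le_exp (2 * s / (1 + s) * l)
    have h4 : β * (2 * s / (1 + s) * l + 1) ≤ (1 + s)⁻¹ ^ 3 * cbVol (K + s • B) :=
      le_trans (by gcongr) h1
    have h5 : (1 + s) ^ 3 * (β * (2 * s / (1 + s) * l + 1)) ≤ cbVol (K + s • B) := by
      calc _ ≤ (1 + s) ^ 3 * ((1 + s)⁻¹ ^ 3 * cbVol (K + s • B)) := by gcongr
        _ = _ := by field_simp
    have h6 : (1 + s) ^ 3 * (β * (2 * s / (1 + s) * l + 1)) = β * (2 * s * (1 + s) ^ 2 * l + (1 + s) ^ 3) := by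
      field_simp
    rw [le_div_iff₀ hs]
    nlinarith
  have hlim2 : Tendsto (fun s : ℝ => (3 + 3 * s + s ^ 2 + 2 * (1 + s) ^ 2 * l) * β) (𝓝[>] 0) (𝓝 ((3 + 2 * l) * β)) := by
    have : Continuous fun s : ℝ => (3 + 3 * s + s ^ 2 + 2 * (1 + s) ^ 2 * l) * β := by fun_prop
    have := (this.tendsto 0).mono_left (nhdsWithin_le_nhds (s := Ioi 0))
    simpa using this
  have h := le_of_tendsto_of_tendsto hlim2 hlim (by
    filter_upwards [Ioo_mem_nhdsGT (zero_lt_one' ℝ)] with s hs using key s hs.1 hs.2)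
  rw [← he] at h
  have hl0 : l ≤ 0 := by nlinarith
  rw [hl, Real.log_nonpos_iff (by positivity), div_le_one hp] at hl0
  exact hl0

noncomputable def cbSl (u : CbE) (X : Set CbE) (x : ℝ) : Set (CbV u) := {y | cbPsi u (x, y) ∈ X}

lemma cbSl_closed (u : CbE) (X : Set CbE) (hX : IsCompact X) (x : ℝ) : MeasurableSet (cbSl u X x) := by
  have : Continuous fun y => cbPsi u (x, y) := (cbPsi_cont u).comp (by fun_prop)
  exact (hX.isClosed.preimage this).measurableSet

lemma cbSl_meas (u : CbE) (X : Set CbE) (hX : IsCompact X) : Measurable fun x => volume (cbSl u X x) := by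
  have hm : MeasurableSet (cbPsi u ⁻¹' X) := (cbPsi_cont u).measurable hX.measurableSet
  exact measurable_measure_prodMk_left hm

lemma cbSl_vol (u : CbE) (hu : ‖u‖ = 1) (X : Set CbE) (hX : IsCompact X) :
    ∫⁻ x, volume (cbSl u X x) = volume X := by
  have hm : MeasurableSet (cbPsi u ⁻¹' X) := (cbPsi_cont u).measurable hX.measurableSet
  rw [← (cbPsi_mp u hu).measure_preimage hX.measurableSet.nullMeasurableSet,
    Measure.volume_eq_prod, Measure.prod_apply hm]
  rfl

lemma cbSl_BM (u : CbE) (hu : ‖u‖ = 1) (X Y : Set CbE) (hX : IsCompact X) (hY : IsCompact Y) (x y : ℝ) :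
    volume (cbSl u X x) ^ (1/2:ℝ) * volume (cbSl u Y y) ^ (1/2:ℝ) ≤
      volume (cbSl u ((1/2:ℝ) • X + (1/2:ℝ) • Y) ((x + y) / 2)) := by
  refine cb_PL_set _ _ (cb_PL_V u hu) (1/2) (1/2) (by norm_num) (by norm_num) (by norm_num) _ _ _
    (cbSl_closed u X hX x) (cbSl_closed u Y hY y) (cbSl_closed u _ ((hX.smul _).add (hY.smul _)) _) ?_
  intro p hp q hq
  have : cbPsi u ((x + y) / 2, (1/2:ℝ) • p + (1/2:ℝ) • q) = (1/2:ℝ) • cbPsi u (x, p) + (1/2:ℝ) • cbPsi u (y, q) := by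
    rw [← map_smul, ← map_smul, ← map_add]
    congr 1
    ext1 <;> simp
    ring
  change cbPsi u _ ∈ (1/2:ℝ) • X + (1/2:ℝ) • Y
  rw [this]
  exact add_mem_add (smul_mem_smul_set hp) (smul_mem_smul_set hq)

lemma cbSl_compact (u : CbE) (hu : ‖u‖ = 1) (X : Set CbE) (hX : IsCompact X) (x : ℝ) : IsCompact (cbSl u X x) := by
  have h1 : IsCompact (cbPsi u ⁻¹' X) := (cbPsi_closedEmb u hu).isCompact_preimage hX
  have h2 : cbSl u X x ⊆ Prod.snd '' (cbPsi u ⁻¹' X) := fun y hy => ⟨(x, y), hy, rfl⟩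
  have : Continuous fun y => cbPsi u (x, y) := (cbPsi_cont u).comp (by fun_prop)
  exact (h1.image continuous_snd).of_isClosed_subset (hX.isClosed.preimage this) h2

lemma cbV_ball (u : CbE) (hu : ‖u‖ = 1) (y : CbV u) (s : ℝ) (hs : 0 ≤ s) :
    volume (Metric.closedBall y s) = ENNReal.ofReal (Real.pi * s ^ 2) := by
  have : Nontrivial (CbV u) := Module.nontrivial_of_finrank_pos (R := ℝ) (by rw [cbV_finrank u hu]; norm_num)
  rw [InnerProductSpace.volume_closedBall_of_dim_even (k := 1) (by rw [cbV_finrank u hu]), cbV_finrank u hu,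
    ← ENNReal.ofReal_pow hs, ← ENNReal.ofReal_mul (by positivity)]
  congr 1
  simp; ring

lemma cbSl_ball (u : CbE) (hu : ‖u‖ = 1) (r x : ℝ) (hr : 0 ≤ r) (hx : x ^ 2 ≤ r ^ 2) :
    volume (cbSl u (Metric.closedBall 0 r) x) = ENNReal.ofReal (Real.pi * (r ^ 2 - x ^ 2)) := by
  have : cbSl u (Metric.closedBall 0 r) x = Metric.closedBall 0 √(r ^ 2 - x ^ 2) := by
    ext y
    rw [cbSl, mem_ofPred_eq, mem_closedBall_zero_iff, mem_closedBall_zero_iff, Real.le_sqrt (norm_nonneg _) (by linarith),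
      ← sq_le_sq₀ (norm_nonneg _) hr, cbPsi_norm u hu]
    constructor <;> intro h <;> simp only at * <;> linarith
  rw [this, cbV_ball u hu _ _ (Real.sqrt_nonneg _), Real.sq_sqrt (by linarith)]

lemma cbVol_ball (r : ℝ) (hr : 0 ≤ r) : cbVol (Metric.closedBall 0 r) = 4 * Real.pi / 3 * r ^ 3 := by
  unfold cbVol
  rw [EuclideanSpace.volume_closedBall_fin_three]
  rw [← ENNReal.ofReal_pow hr, ← ENNReal.ofReal_mul (by positivity), ENNReal.toReal_ofReal (by positivity)]
  ring

lemma cb_width (u : CbE) (hu : ‖u‖ = 1) (K : Set CbE) (hK : IsCompact K) (r : ℝ) (hr : 0 < r)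
    (he : cbVol K = cbVol (Metric.closedBall 0 r))
    (hh : cbVol ((1/2:ℝ) • K + (1/2:ℝ) • (Metric.closedBall 0 r)) ≤ cbVol K) :
    volume {x | 0 < (volume (cbSl u K x)).toReal} ≤ ENNReal.ofReal (2 * r) := by
  have hB : IsCompact (Metric.closedBall (0:CbE) r) := isCompact_closedBall _ _
  have hfin : ∀ x, volume (cbSl u K x) ≠ ∞ := fun x => (cbSl_compact u hu K hK x).measure_lt_top.ne
  have hint : ∫⁻ x, volume (cbSl u K x) ≠ ∞ := by rw [cbSl_vol u hu K hK]; exact hK.measure_lt_top.ne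
  refine cb_transport (fun x => (volume (cbSl u K x)).toReal) (fun y => Real.pi * (r ^ 2 - y ^ 2))
    (fun y => Real.pi * (r ^ 2 * y - y ^ 3 / 3 + 2 * r ^ 3 / 3))
    (fun z => volume (cbSl u ((1/2:ℝ) • K + (1/2:ℝ) • (Metric.closedBall 0 r)) z)) r (cbVol K) hr
    (cbSl_meas u K hK).ennreal_toReal (by fun_prop) (integrable_toReal_of_lintegral_ne_top (cbSl_meas u K hK).aemeasurable hint)
    (fun _ => ENNReal.toReal_nonneg) ?_ ?_ ?_ (by fun_prop) (by ring) ?_ ?_ ?_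
  · rw [integral_toReal (cbSl_meas u K hK).aemeasurable (Eventually.of_forall fun x => (hfin x).lt_top),
      cbSl_vol u hu K hK]; rfl
  · intro y hy
    have : y ^ 2 < r ^ 2 := sq_lt_sq.mpr (by rw [abs_of_pos hr]; exact abs_lt.mpr hy)
    exact mul_pos Real.pi_pos (by linarith)
  · intro y hy
    have := ((((hasDerivAt_id y).const_mul (r ^ 2)).sub ((hasDerivAt_pow 3 y).div_const 3)).add_const
      (2 * r ^ 3 / 3)).const_mul Real.pi
    refine this.congr_deriv ?_
    simp
  · rw [he, cbVol_ball r hr.le]; ring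
  · intro x y
    by_cases hy : y ^ 2 ≤ r ^ 2
    · refine le_trans (le_of_eq ?_) (cbSl_BM u hu K (Metric.closedBall 0 r) hK hB x y)
      rw [cbSl_ball u hu r y hr.le hy, ← ENNReal.mul_rpow_of_nonneg _ _ (by norm_num), Real.sqrt_eq_rpow,
        ← ENNReal.ofReal_rpow_of_nonneg (mul_nonneg ENNReal.toReal_nonneg (mul_nonneg Real.pi_pos.le (by linarith)))
          (by norm_num), ENNReal.ofReal_mul ENNReal.toReal_nonneg, ENNReal.ofReal_toReal (hfin x)]
    · rw [Real.sqrt_eq_zero_of_nonpos]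
      · simp
      · exact mul_nonpos_of_nonneg_of_nonpos ENNReal.toReal_nonneg
          (mul_nonpos_of_nonneg_of_nonpos Real.pi_pos.le (by linarith))
  · have hc := (hK.smul (1/2:ℝ)).add (hB.smul (1/2:ℝ))
    rw [cbSl_vol u hu _ hc]
    exact (ENNReal.le_ofReal_iff_toReal_le hc.measure_lt_top.ne ENNReal.toReal_nonneg).mpr hh

lemma cb_subset_ball (K : Set CbE) (hK : IsCompact K) (hKc : Convex ℝ K) (hs : ∀ x ∈ K, -x ∈ K)
    (δ : ℝ) (hδ : 0 < δ) (hδK : Metric.closedBall 0 δ ⊆ K) (r : ℝ) (hr : 0 < r)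
    (hw : ∀ u : CbE, ‖u‖ = 1 → volume {x | 0 < (volume (cbSl u K x)).toReal} ≤ ENNReal.ofReal (2 * r)) :
    K ⊆ Metric.closedBall 0 r := by
  intro p hp
  rw [mem_closedBall_zero_iff]
  by_cases hp0 : p = 0
  · simp [hp0, hr.le]
  set a := ‖p‖ with ha
  have ha0 : 0 < a := norm_pos_iff.mpr hp0
  set u := a⁻¹ • p with hu
  have hu1 : ‖u‖ = 1 := by rw [hu, norm_smul, norm_inv, norm_norm, ← ha]; field_simp
  have hpu : p = a • u := by rw [hu, smul_smul]; field_simp; simp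
  have hsub : Ioo (-a) a ⊆ {x | 0 < (volume (cbSl u K x)).toReal} := by
    intro x hx
    set θ := |x| / a with hθ
    have hx' : |x| < a := abs_lt.mpr hx
    have hθ1 : θ < 1 := (div_lt_one ha0).mpr hx'
    have hθ0 : 0 ≤ θ := by positivity
    have hq : ∃ q ∈ K, x • u = θ • q := by
      rcases le_total 0 x with h | h
      · refine ⟨p, hp, ?_⟩
        rw [hpu, smul_smul, hθ, abs_of_nonneg h]; congr 1; try field_simp
      · refine ⟨-p, hs p hp, ?_⟩
        rw [hpu, smul_neg, smul_smul, hθ, abs_of_nonpos h, ← neg_smul]; congr 1; field_simp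
    obtain ⟨q, hqK, hq⟩ := hq
    have hball : Metric.closedBall (0 : CbV u) ((1 - θ) * δ) ⊆ cbSl u K x := by
      intro y hy
      rw [mem_closedBall_zero_iff] at hy
      change cbPsi u (x, y) ∈ K
      rw [cbPsi_apply]
      simp only
      have h1 : 0 < 1 - θ := by linarith
      have e : (y : CbE) = (1 - θ) • ((1 - θ)⁻¹ • (y : CbE)) := by
        rw [smul_smul, mul_inv_cancel₀ h1.ne', one_smul]
      rw [hq, e]
      refine hKc hqK (hδK ?_) hθ0 h1.le (by ring)
      rw [mem_closedBall_zero_iff, norm_smul, norm_inv, Real.norm_eq_abs, abs_of_pos h1, inv_mul_le_iff₀ h1]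
      exact hy
    have hpos : 0 < volume (cbSl u K x) := by
      refine lt_of_lt_of_le ?_ (measure_mono hball)
      have h1 : 0 < 1 - θ := by linarith
      rw [cbV_ball u hu1 _ _ (by positivity)]
      rw [ENNReal.ofReal_pos]
      positivity
    exact ENNReal.toReal_pos hpos.ne' (cbSl_compact u hu1 K hK x).measure_lt_top.ne
  have h := (measure_mono hsub).trans (hw u hu1)
  rw [Real.volume_Ioo, ENNReal.ofReal_le_ofReal_iff (by positivity)] at h
  linarith

lemma cb_eq_ball (K : Set CbE) (hK : IsCompact K) (r : ℝ) (hr : 0 < r) (hsub : K ⊆ Metric.closedBall 0 r)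
    (he : cbVol K = cbVol (Metric.closedBall 0 r)) : K = Metric.closedBall 0 r := by
  apply Subset.antisymm hsub
  have h1 : volume (Metric.ball (0:CbE) r \ K) = 0 := by
    have h2 : volume (Metric.closedBall (0:CbE) r \ K) = 0 := by
      rw [measure_sdiff hsub hK.measurableSet.nullMeasurableSet hK.measure_lt_top.ne]
      have : volume K = volume (Metric.closedBall (0:CbE) r) :=
        (ENNReal.toReal_eq_toReal_iff' hK.measure_lt_top.ne measure_closedBall_lt_top.ne).mp he
      rw [this, tsub_self]
    exact measure_mono_null (sdiff_subset_sdiff_left Metric.ball_subset_closedBall) h2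
  have h3 : Metric.ball (0:CbE) r ⊆ K := by
    have := (Metric.isOpen_ball.sdiff hK.isClosed).measure_eq_zero_iff volume |>.mp h1
    exact sdiff_eq_empty.mp this
  rw [← closure_ball _ hr.ne']
  exact closure_minimal h3 hK.isClosed

theorem cb_final (K : Set CbE) (hK : IsCompact K) (hKc : Convex ℝ K) (hs : ∀ x ∈ K, -x ∈ K)
    (δ : ℝ) (hδ : 0 < δ) (hδK : Metric.closedBall 0 δ ⊆ K) (r : ℝ) (hr : 0 < r) (b : ℝ)
    (hb : CbBr K b) (hbB : CbBr (Metric.closedBall 0 r) b) : K = Metric.closedBall 0 r := by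
  have hB : IsCompact (Metric.closedBall (0:CbE) r) := isCompact_closedBall _ _
  have hBc : Convex ℝ (Metric.closedBall (0:CbE) r) := convex_closedBall _ _
  have hsB : ∀ x ∈ Metric.closedBall (0:CbE) r, -x ∈ Metric.closedBall (0:CbE) r := by simp
  have h0K : K.Nonempty := ⟨0, hδK (by simp [hδ.le])⟩
  have h0B : (Metric.closedBall (0:CbE) r).Nonempty := ⟨0, by simp [hr.le]⟩
  have hpB : 0 < cbVol (Metric.closedBall 0 r) := by rw [cbVol_ball r hr.le]; positivity
  have hpK : 0 < cbVol K := by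
    refine lt_of_lt_of_le ?_ (cbVol_mono hδK hK)
    rw [cbVol_ball δ hδ.le]; positivity
  have l1 := cb_mix K (Metric.closedBall 0 r) hK hKc hB hBc h0B hsB b hb hbB
  have l2 := cb_mix (Metric.closedBall 0 r) K hB hBc hK hKc h0K hs b hbB hb
  have he : cbVol K = cbVol (Metric.closedBall 0 r) :=
    le_antisymm (cb_vol_le _ _ hK hB hpK hpB l1) (cb_vol_le _ _ hB hK hpB hpK l2)
  have hh := cb_half K _ hK hB hKc hpK hpB he l1
  exact cb_eq_ball K hK r hr (cb_subset_ball K hK hKc hs δ hδ hδK r hr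
    fun u hu => cb_width u hu K hK r hr he hh) he
end CbF3

section CbG1
open MeasureTheory Set Filter Topology
open scoped ENNReal Pointwise

noncomputable def cbKap : ℝ≥0∞ :=
  ((Measure.addHaarScalarFactor (volume : Measure (EuclideanSpace ℝ (Fin 2))) μH[(2:ℕ)] : NNReal) : ℝ≥0∞)

lemma cb_proj_haus (u : CbE) (hu : ‖u‖ = 1) (X : Set CbE) :
    volume (cbProj u X) = cbKap * μH[(2:ℝ)]
      ((fun x => ((CbV u).orthogonalProjectionOnto x : CbE)) '' X) := by
  have h1 : (fun x => ((CbV u).orthogonalProjectionOnto x : CbE)) '' X = Subtype.val '' (cbProj u X) := by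
    rw [cbProj, image_image]
  have h2 : (volume : Measure (CbV u)) = μHE[2] := by
    rw [← InnerProductSpace.euclideanHausdorffMeasure_eq_volume, cbV_finrank u hu]
  have h3 : μHE[2] (Subtype.val '' (cbProj u X)) = μHE[2] (cbProj u X) :=
    isometry_subtype_coe.euclideanHausdorffMeasure_image _
  rw [h1, h2, ← h3, Measure.euclideanHausdorffMeasure_def]
  rfl

lemma cb_proj_trans (u : CbE) (X : Set CbE) (c : CbE) :
    volume (cbProj u ((fun x => x - c) '' X)) = volume (cbProj u X) := by
  have : cbProj u ((fun x => x - c) '' X) = (fun y => y + -(CbV u).orthogonalProjectionOnto c) '' (cbProj u X) := by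
    rw [cbProj, cbProj, image_image, image_image]
    refine image_congr fun x _ => ?_
    rw [map_sub, sub_eq_add_neg]
  rw [this, image_add_right, measure_preimage_add_right]

lemma cb_br (X : Set CbE) (hX : IsCompact X) (hc : Convex ℝ X) (A : ℝ)
    (h : ∀ u, ‖u‖ = 1 → (volume (cbProj u X)).toReal = A) : CbBr X (2 * A) := by
  intro u
  by_cases hu : u = 0
  · subst hu; simp [cbSeg_zero]
  have h0 : ‖u‖ ≠ 0 := by simpa using hu
  have h1 : ‖(‖u‖⁻¹ • u)‖ = 1 := by rw [norm_smul]; simp [h0]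
  have := cb_seg_unit _ h1 X hX hc ‖u‖ (norm_nonneg _)
  rw [smul_smul, mul_inv_cancel₀ h0, one_smul, h _ h1] at this
  rw [this]; ring

lemma cb_proj_ball (u : CbE) (hu : ‖u‖ = 1) (r : ℝ) (hr : 0 ≤ r) :
    volume (cbProj u (Metric.closedBall 0 r)) = ENNReal.ofReal (Real.pi * r ^ 2) := by
  have : cbProj u (Metric.closedBall 0 r) = Metric.closedBall 0 r := by
    apply Subset.antisymm
    · rintro _ ⟨x, hx, rfl⟩
      rw [mem_closedBall_zero_iff] at *
      exact ((CbV u).norm_orthogonalProjectionOnto_apply_le x).trans hx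
    · intro y hy
      rw [mem_closedBall_zero_iff] at hy
      refine ⟨(y : CbE), by rw [mem_closedBall_zero_iff]; exact hy, ?_⟩
      simp
  rw [this, cbV_ball u hu _ _ hr]

theorem cb_main (K : Set CbE)
    (hKcomp : IsCompact K) (hKconv : Convex ℝ K) (hKint : (interior K).Nonempty)
    (hsymm : ∃ c : CbE, K = (fun x => (2 : ℝ) • c - x) '' K)
    (hbright : ∃ b : ENNReal, ∀ u : CbE, ‖u‖ = 1 →
      μH[(2 : ℝ)] ((fun x => ((CbV u).orthogonalProjectionOnto x : CbE)) '' K) = b) :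
    ∃ (c : CbE) (r : ℝ), K = Metric.closedBall c r := by
  obtain ⟨c, hc⟩ := hsymm
  obtain ⟨b, hb⟩ := hbright
  set L : Set CbE := (fun x => x - c) '' K with hL
  have hmemL : ∀ x, x ∈ L ↔ x + c ∈ K := by
    intro x
    constructor
    · rintro ⟨y, hy, rfl⟩; simpa using hy
    · intro h; exact ⟨x + c, h, by simp⟩
  have hLcomp : IsCompact L := hKcomp.image (by fun_prop)
  have hLconv : Convex ℝ L := by
    have := hKconv.translate (-c)
    convert this using 2
    ext x; simp; abel
  have hLs : ∀ x ∈ L, -x ∈ L := by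
    intro x hx
    rw [hmemL] at *
    rw [hc]
    exact ⟨x + c, hx, by simp [two_smul]; abel⟩
  have hLint : (0 : CbE) ∈ interior L := by
    obtain ⟨p, hp⟩ := hKint
    have h1 : p - c ∈ interior L := by
      have : IsOpen ((fun x => x + c) ⁻¹' (interior K)) := isOpen_interior.preimage (by fun_prop)
      refine mem_interior.mpr ⟨_, ?_, this, by simpa using hp⟩
      intro x hx
      rw [hmemL]; exact interior_subset hx
    have h2 : -(p - c) ∈ interior L := by
      have : IsOpen ((fun x : CbE => -x) ⁻¹' (interior L)) := isOpen_interior.preimage (by fun_prop)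
      refine mem_interior.mpr ⟨_, ?_, this, by simpa using h1⟩
      intro x hx
      have := hLs _ (interior_subset hx)
      simpa using this
    have := hLconv.interior h1 h2 (a := 1/2) (b := 1/2) (by norm_num) (by norm_num) (by norm_num)
    rwa [smul_neg, add_neg_cancel] at this
  obtain ⟨δ, hδ, hδL⟩ := Metric.nhds_basis_closedBall.mem_iff.mp (mem_interior_iff_mem_nhds.mp hLint)
  set A : ℝ := (cbKap * b).toReal with hA
  have hpr : ∀ u, ‖u‖ = 1 → (volume (cbProj u L)).toReal = A := by
    intro u hu
    rw [hL, cb_proj_trans, cb_proj_haus u hu, hb u hu]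
  have hApos : 0 < A := by
    have hu : ‖(EuclideanSpace.single 0 1 : CbE)‖ = 1 := by simp
    rw [← hpr _ hu]
    refine ENNReal.toReal_pos ?_ ?_
    · have h1 := cb_proj_ball _ hu δ hδ.le
      have h2 : volume (cbProj (EuclideanSpace.single 0 1 : CbE) (Metric.closedBall 0 δ)) ≤
        volume (cbProj (EuclideanSpace.single 0 1 : CbE) L) := measure_mono (image_mono hδL)
      rw [h1] at h2
      exact (lt_of_lt_of_le (by rw [ENNReal.ofReal_pos]; positivity) h2).ne'
    · exact (hLcomp.image (ContinuousLinearMap.continuous _)).measure_lt_top.ne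
  set r := √(A / Real.pi) with hr
  have hr0 : 0 < r := by positivity
  have hrB : ∀ u, ‖u‖ = 1 → (volume (cbProj u (Metric.closedBall 0 r))).toReal = A := by
    intro u hu
    rw [cb_proj_ball u hu r hr0.le, ENNReal.toReal_ofReal (by positivity), hr, Real.sq_sqrt (by positivity)]
    field_simp
  have hfin := cb_final L hLcomp hLconv hLs δ hδ hδL r hr0 (2 * A) (cb_br L hLcomp hLconv A hpr)
    (cb_br _ (isCompact_closedBall _ _) (convex_closedBall _ _) A hrB)
  refine ⟨c, r, ?_⟩
  ext x
  have h := hmemL (x - c)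
  rw [sub_add_cancel] at h
  rw [← h, hfin, mem_closedBall_zero_iff, mem_closedBall_iff_norm]
end CbG1

theorem centrally_symmetric_constant_brightness_is_ball
    (K : Set (EuclideanSpace ℝ (Fin 3)))
    (hKcomp : IsCompact K) (hKconv : Convex ℝ K) (hKint : (interior K).Nonempty)
    (hsymm : ∃ c : EuclideanSpace ℝ (Fin 3), K = (fun x => (2 : ℝ) • c - x) '' K)
    (hbright : ∃ b : ENNReal, ∀ u : EuclideanSpace ℝ (Fin 3), ‖u‖ = 1 →
      μH[(2 : ℝ)] (shadow u K) = b) :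
    ∃ (c : EuclideanSpace ℝ (Fin 3)) (r : ℝ), K = Metric.closedBall c r := by
  exact cb_main K hKcomp hKconv hKint hsymm hbright
end

section
/- Let K be a convex body in ℝ^n that is centrally symmetric with centre the origin (K = −K), and suppose there exists τ > 0 such that the function x ↦ vol_n(K ∩ (τK + x)) depends only on the Minkowski norm ‖x‖_K, i.e. whenever ‖x‖_K = ‖y‖_K one has vol_n(K ∩ (τK + x)) = vol_n(K ∩ (τK + y)). Then K is an ellipsoid, i.e. the image of the closed Euclidean unit ball under an invertible linear map. -/
open MeasureTheory Pointwise

namespace MRS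
open Set
open scoped ENNReal

variable {n : ℕ}

local notation "EE" => EuclideanSpace ℝ (Fin n)

noncomputable def phi (k : ℕ) (θ : EuclideanSpace ℝ (Fin n)) (x : EuclideanSpace ℝ (Fin n)) : ℝ≥0∞ :=
  ENNReal.ofReal ((inner ℝ x θ) ^ (2 * k))

lemma phi_meas (k : ℕ) (θ : EE) : Measurable (phi k θ) := by
  unfold phi; fun_prop

lemma phi_smul (k : ℕ) (θ x : EE) (r : ℝ) :
    phi k θ (r • x) = ENNReal.ofReal (r ^ (2 * k)) * phi k θ x := by
  unfold phi
  rw [← ENNReal.ofReal_mul (by rw [pow_mul]; positivity), inner_smul_left, mul_pow]; simp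

lemma lint_scale (F : EE → ℝ≥0∞) (hF : Measurable F) {r : ℝ} (hr : r ≠ 0) :
    ∫⁻ x, F (r • x) = ENNReal.ofReal (abs (r ^ n)⁻¹) * ∫⁻ x, F x := by
  have := Measure.map_addHaar_smul (volume : Measure EE) hr
  rw [finrank_euclideanSpace_fin] at this
  rw [← smul_eq_mul, ← lintegral_smul_measure, ← this, lintegral_map hF (measurable_const_smul r)]

section body
variable {K : Set (EuclideanSpace ℝ (Fin n))}
    (hc : IsCompact K) (hv : Convex ℝ K) (h0 : K ∈ nhds 0) (hs : ∀ x ∈ K, -x ∈ K)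

noncomputable def LL (K : Set (EuclideanSpace ℝ (Fin n))) (k : ℕ) (θ : EuclideanSpace ℝ (Fin n)) : ℝ≥0∞ :=
  ∫⁻ x in K, phi k θ x

include hc hv h0 in
lemma gauge_le_one (x : EE) : gauge K x ≤ 1 ↔ x ∈ K := by
  rw [gauge_le_one_iff_mem_closure hv h0, hc.isClosed.closure_eq]

include hc hv h0 in
lemma gauge_le (x : EE) {r : ℝ} (hr : 0 < r) : gauge K x ≤ r ↔ r⁻¹ • x ∈ K := by
  rw [← gauge_le_one hc hv h0, gauge_smul_of_nonneg (inv_nonneg.2 hr.le), smul_eq_mul,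
    inv_mul_le_iff₀ hr, mul_one]

include hc in
lemma LL_ne_top (k : ℕ) (θ : EE) : LL K k θ ≠ ∞ := by
  have : IntegrableOn (fun x : EE => (inner ℝ x θ : ℝ) ^ (2 * k)) K := by
    apply ContinuousOn.integrableOn_compact hc
    fun_prop
  exact this.lintegral_lt_top.ne

include hc hv h0 in
lemma lint_gauge_le (hn : n ≠ 0) (k : ℕ) (r : ℝ) : ∃ c : ℝ≥0∞, ∀ θ : EE,
    ∫⁻ x in {x | gauge K x ≤ r}, phi k θ x = c * LL K k θ := by
  rcases lt_trichotomy r 0 with hr | hr | hr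
  · refine ⟨0, fun θ => ?_⟩
    have : {x | gauge K x ≤ r} = ∅ := by
      ext x; simp; exact hr.trans_le (gauge_nonneg x)
    simp [this]
  · refine ⟨0, fun θ => ?_⟩
    have hsub : {x | gauge K x ≤ r} ⊆ {0} := by
      intro x hx
      change gauge K x ≤ r at hx
      rw [hr] at hx
      exact (gauge_eq_zero (absorbent_nhds_zero h0) ((NormedSpace.isVonNBounded_iff ℝ).2 hc.isBounded)).1
        (le_antisymm hx (gauge_nonneg x))
    have : Nonempty (Fin n) := ⟨⟨0, Nat.pos_of_ne_zero hn⟩⟩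
    rw [Measure.restrict_eq_zero.2 (measure_mono_null hsub (measure_singleton 0))]
    simp
  · refine ⟨ENNReal.ofReal (r ^ (2 * k)) * ENNReal.ofReal (abs ((r⁻¹) ^ n)⁻¹), fun θ => ?_⟩
    have hm : MeasurableSet {x | gauge K x ≤ r} :=
      (isClosed_le (continuous_gauge hv h0) continuous_const).measurableSet
    have hK := hc.measurableSet
    rw [LL, ← lintegral_indicator hK, ← lintegral_indicator hm, mul_assoc,
      ← lint_scale _ ((phi_meas k θ).indicator hK) (inv_ne_zero hr.ne'),
      ← lintegral_const_mul]
    · congr 1; ext x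
      by_cases hx : r⁻¹ • x ∈ K
      · rw [indicator_of_mem hx, indicator_of_mem, ← phi_smul, smul_inv_smul₀ hr.ne']
        exact (gauge_le hc hv h0 x hr).2 hx
      · rw [indicator_of_notMem hx, indicator_of_notMem, mul_zero]
        exact fun h => hx ((gauge_le hc hv h0 x hr).1 h)
    · exact ((phi_meas k θ).indicator hK).comp (measurable_const_smul _)

include hc hv h0 in
lemma lint_radial (hn : n ≠ 0) (k : ℕ) (R : ℝ) (g : ℝ → ℝ≥0∞) (hg : Measurable g) (θ θ' : EE) :
    LL K k θ' * ∫⁻ x in {x | gauge K x ≤ R}, g (gauge K x) * phi k θ x =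
    LL K k θ * ∫⁻ x in {x | gauge K x ≤ R}, g (gauge K x) * phi k θ' x := by
  have hgm : Measurable (gauge K) := (continuous_gauge hv h0).measurable
  have key : ∀ θ : EE, ∫⁻ x in {x | gauge K x ≤ R}, g (gauge K x) * phi k θ x =
      ∫⁻ t, g t ∂(((volume.restrict {x | gauge K x ≤ R}).withDensity (phi k θ)).map (gauge K)) := by
    intro θ
    have := lintegral_withDensity_eq_lintegral_mul (volume.restrict {x | gauge K x ≤ R})
      (phi_meas k θ) (hg.comp hgm)
    rw [lintegral_map hg hgm]
    refine Eq.trans ?_ this.symm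
    congr 1; ext x; simp [mul_comm]
  have hv1 : ∀ (θ : EE) (r : ℝ), (((volume.restrict {x | gauge K x ≤ R}).withDensity (phi k θ)).map (gauge K)) (Iic r)
      = ∫⁻ x in {x | gauge K x ≤ min r R}, phi k θ x := by
    intro θ r
    rw [Measure.map_apply hgm measurableSet_Iic, withDensity_apply _ (hgm measurableSet_Iic),
      Measure.restrict_restrict (hgm measurableSet_Iic)]
    congr 2; ext x; simp
  have hfin : ∀ θ : EE, IsFiniteMeasure (((volume.restrict {x | gauge K x ≤ R}).withDensity (phi k θ)).map (gauge K)) := by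
    intro θ
    obtain ⟨c, hc'⟩ := lint_gauge_le hc hv h0 hn k (max R 1)
    have hmm : ∫⁻ x in {x | gauge K x ≤ R}, phi k θ x < ∞ := by
      have hR : 0 < max R 1 := lt_max_of_lt_right one_pos
      have hcpt : IsCompact {x | gauge K x ≤ max R 1} := by
        have : {x | gauge K x ≤ max R 1} = (max R 1) • K := by
          ext x; rw [mem_smul_set_iff_inv_smul_mem₀ hR.ne', ← gauge_le hc hv h0 x hR]; rfl
        rw [this]; exact hc.smul _
      have : IntegrableOn (fun x : EE => (inner ℝ x θ : ℝ) ^ (2 * k)) {x | gauge K x ≤ max R 1} := by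
        apply ContinuousOn.integrableOn_compact hcpt
        fun_prop
      refine lt_of_le_of_lt (lintegral_mono_set ?_) this.lintegral_lt_top
      intro x hx
      change gauge K x ≤ R at hx
      exact hx.trans (le_max_left R 1)
    have := isFiniteMeasure_withDensity hmm.ne
    infer_instance
  have := hfin θ
  have := hfin θ'
  rw [key, key, ← smul_eq_mul, ← smul_eq_mul, ← lintegral_smul_measure, ← lintegral_smul_measure]
  congr 1
  have f1 := LL_ne_top hc k θ
  have f2 := LL_ne_top hc k θ'
  have i1 := Measure.smul_finite (((volume.restrict {x | gauge K x ≤ R}).withDensity (phi k θ)).map (gauge K)) f2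
  have i2 := Measure.smul_finite (((volume.restrict {x | gauge K x ≤ R}).withDensity (phi k θ')).map (gauge K)) f1
  apply Measure.ext_of_Iic
  intro r
  rw [Measure.smul_apply, Measure.smul_apply, hv1, hv1, smul_eq_mul, smul_eq_mul]
  obtain ⟨c, hc'⟩ := lint_gauge_le hc hv h0 hn k (min r R)
  rw [hc', hc']; ring

lemma mem_img {τ : ℝ} (hτ : 0 < τ) (w z : EE) :
    w ∈ (fun y => τ • y + z) '' K ↔ τ⁻¹ • (w - z) ∈ K := by
  constructor
  · rintro ⟨y, hy, rfl⟩
    simpa [smul_smul, hτ.ne'] using hy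
  · intro h
    exact ⟨_, h, by simp [smul_smul, hτ.ne']⟩

def SS (K : Set (EuclideanSpace ℝ (Fin n))) (τ : ℝ) :
    Set (EuclideanSpace ℝ (Fin n) × EuclideanSpace ℝ (Fin n)) :=
  {p | p.2 ∈ K ∧ τ⁻¹ • (p.2 - p.1) ∈ K}

include hc in
lemma SS_meas (τ : ℝ) : MeasurableSet (SS K τ) := by
  have h1 : Measurable (fun p : EE × EE => p.2) := by fun_prop
  have h2 : Measurable (fun p : EE × EE => τ⁻¹ • (p.2 - p.1)) := by fun_prop
  exact (h1 hc.measurableSet).inter (h2 hc.measurableSet)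

lemma inter_eq {τ : ℝ} (hτ : 0 < τ) (z : EE) :
    K ∩ ((fun y => τ • y + z) '' K) = Prod.mk z ⁻¹' (SS K τ) := by
  ext w
  rw [mem_inter_iff, mem_img hτ]; rfl

include hc in
lemma f_meas {τ : ℝ} (hτ : 0 < τ) :
    Measurable (fun z : EE => volume (K ∩ ((fun y => τ • y + z) '' K))) := by
  simp_rw [inter_eq hτ]
  exact measurable_measure_prodMk_left (SS_meas hc τ)

include hc in
/-- Tonelli -/
lemma lint_conv (k : ℕ) {τ : ℝ} (hτ : 0 < τ) (θ : EE) :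
    ∫⁻ z, volume (K ∩ ((fun y => τ • y + z) '' K)) * phi k θ z =
      ENNReal.ofReal (τ ^ n) * ∫⁻ w in K, ∫⁻ y in K, phi k θ (w - τ • y) := by
  have hS := SS_meas hc τ
  have hK := hc.measurableSet
  have e1 : ∀ z : EE, volume (K ∩ ((fun y => τ • y + z) '' K)) * phi k θ z =
      ∫⁻ w, (SS K τ).indicator (fun p => phi k θ p.1) (z, w) := by
    intro z
    rw [inter_eq hτ, mul_comm, ← lintegral_indicator_const (measurable_prodMk_left hS)]
    rfl
  simp_rw [e1]
  rw [lintegral_lintegral_swap]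
  swap
  · exact (((phi_meas k θ).comp measurable_fst).indicator hS).aemeasurable
  have hmm : Measurable (fun p : EE × EE => phi k θ (p.1 - τ • p.2)) :=
    (phi_meas k θ).comp (by fun_prop)
  rw [← lintegral_const_mul _ (hmm.lintegral_prod_right' (ν := volume.restrict K)),
    ← lintegral_indicator hK]
  congr 1; ext w
  by_cases hw : w ∈ K
  · rw [indicator_of_mem hw, ← lintegral_sub_left_eq_self _ w, ← lintegral_indicator hK]
    have hmw : Measurable (K.indicator fun y => phi k θ (w - τ • y)) :=
      ((phi_meas k θ).comp (by fun_prop)).indicator hK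
    have := lint_scale _ hmw (inv_ne_zero hτ.ne')
    rw [inv_pow, inv_inv, abs_of_pos (pow_pos hτ n)] at this
    rw [← this]
    congr 1; ext u
    by_cases hu : τ⁻¹ • u ∈ K
    · rw [indicator_of_mem hu, indicator_of_mem]
      · rw [smul_inv_smul₀ hτ.ne']
      · exact ⟨hw, by simpa using hu⟩
    · rw [indicator_of_notMem hu, indicator_of_notMem]
      exact fun h => hu (by simpa using h.2)
  · rw [indicator_of_notMem hw]
    rw [lintegral_eq_zero_iff']
    · filter_upwards with z
      rw [indicator_of_notMem]; rfl
      exact fun h => hw h.1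
    · exact ((((phi_meas k θ).comp measurable_fst).indicator hS).comp measurable_prodMk_right).aemeasurable

include hc hv h0 hs in
lemma stepA_enn (hn : n ≠ 0) (k : ℕ) {τ : ℝ} (hτ : 0 < τ)
    (h : ∀ x y : EE, gauge K x = gauge K y →
      volume (K ∩ ((fun z => τ • z + x) '' K)) = volume (K ∩ ((fun z => τ • z + y) '' K)))
    (hpos : ∃ θ : EE, LL K k θ ≠ 0) :
    ∃ C : ℝ≥0∞, ∀ θ : EE, ∫⁻ w in K, ∫⁻ y in K, phi k θ (w - τ • y) = C * LL K k θ := by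
  obtain ⟨θ₀, hθ₀⟩ := hpos
  have : Nonempty (Fin n) := ⟨⟨0, Nat.pos_of_ne_zero hn⟩⟩
  obtain ⟨v, hv0⟩ := exists_ne (0 : EE)
  have hgv : 0 < gauge K v :=
    (gauge_pos (absorbent_nhds_zero h0) ((NormedSpace.isVonNBounded_iff ℝ).2 hc.isBounded)).2 hv0
  set u : EE := (gauge K v)⁻¹ • v with hu
  have hgu : gauge K u = 1 := by
    rw [hu, gauge_smul_of_nonneg (inv_nonneg.2 hgv.le), smul_eq_mul, inv_mul_cancel₀ hgv.ne']
  set f : EE → ℝ≥0∞ := fun z : EE => volume (K ∩ ((fun y => τ • y + z) '' K)) with hf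
  have hfm : Measurable f := f_meas hc hτ
  set g : ℝ → ℝ≥0∞ := fun r => f (r • u) with hg
  have hgm : Measurable g := hfm.comp (by fun_prop)
  have hfg : ∀ z, f z = g (gauge K z) := by
    intro z
    apply h
    rw [gauge_smul_of_nonneg (gauge_nonneg z), hgu, smul_eq_mul, mul_one]
  have hsupp : ∀ z, f z ≠ 0 → gauge K z ≤ 1 + τ := by
    intro z hz
    have hne : (K ∩ ((fun y => τ • y + z) '' K)).Nonempty := by
      rw [nonempty_iff_ne_empty]; intro he; apply hz; simp [hf, he]
    obtain ⟨w, hw, y, hy, rfl⟩ := hne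
    have h1 : 0 < 1 + τ := by positivity
    rw [gauge_le hc hv h0 z h1]
    have := hv hw (hs y hy) (inv_nonneg.2 h1.le) (mul_nonneg (inv_nonneg.2 h1.le) hτ.le)
      (by field_simp)
    convert this using 1
    simp only [smul_add, smul_neg, smul_smul]; abel
  have hI : ∀ θ : EE, ∫⁻ z, f z * phi k θ z =
      ∫⁻ x in {x | gauge K x ≤ 1 + τ}, g (gauge K x) * phi k θ x := by
    intro θ
    simp_rw [← hfg]
    rw [setLIntegral_eq_of_support_subset]
    intro z hz
    apply hsupp
    intro h'
    apply hz
    simp [h']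
  have hτn : ENNReal.ofReal (τ ^ n) ≠ 0 := by simpa using pow_pos hτ n
  set J : EE → ℝ≥0∞ := fun θ => ∫⁻ w in K, ∫⁻ y in K, phi k θ (w - τ • y) with hJ
  refine ⟨J θ₀ * (LL K k θ₀)⁻¹, fun θ => ?_⟩
  have h1 := lint_radial hc hv h0 hn k (1 + τ) g hgm θ θ₀
  rw [← hI, ← hI, lint_conv hc k hτ, lint_conv hc k hτ] at h1
  change LL K k θ₀ * (ENNReal.ofReal (τ ^ n) * J θ) = LL K k θ * (ENNReal.ofReal (τ ^ n) * J θ₀) at h1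
  change J θ = _
  rw [mul_left_comm, mul_left_comm (LL K k θ)] at h1
  have h2 := (ENNReal.mul_right_inj hτn ENNReal.ofReal_ne_top).1 h1
  calc J θ = (LL K k θ₀)⁻¹ * (LL K k θ₀ * J θ) := by
        rw [← mul_assoc, ENNReal.inv_mul_cancel hθ₀ (LL_ne_top hc k θ₀), one_mul]
    _ = _ := by rw [h2]; ring

noncomputable def MM (K : Set (EuclideanSpace ℝ (Fin n))) (k : ℕ) (θ : EuclideanSpace ℝ (Fin n)) : ℝ :=
  ∫ x in K, (inner ℝ x θ : ℝ) ^ k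

lemma MM_even (k : ℕ) (θ : EE) : MM K (2 * k) θ = (LL K k θ).toReal := by
  unfold MM LL phi
  rw [integral_eq_lintegral_of_nonneg_ae]
  · filter_upwards with x
    rw [pow_mul]; simp only [Pi.zero_apply]; positivity
  · exact (by fun_prop : Continuous fun x : EE => (inner ℝ x θ : ℝ) ^ (2 * k)).aestronglyMeasurable

include hc in
lemma intK (k : ℕ) (θ : EE) : IntegrableOn (fun x : EE => (inner ℝ x θ : ℝ) ^ k) K :=
  ContinuousOn.integrableOn_compact hc (by fun_prop)

include hs in
lemma MM_odd (k : ℕ) (hk : Odd k) (θ : EE) : MM K k θ = 0 := by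
  have hKn : -K = K := by
    ext x; exact ⟨fun h => by simpa using hs _ h, fun h => hs _ h⟩
  have : MM K k θ = - MM K k θ := by
    have h1 := (Measure.measurePreserving_neg (volume : Measure EE)).setIntegral_preimage_emb
      (MeasurableEquiv.neg EE).measurableEmbedding (fun x => (inner ℝ x θ : ℝ) ^ k) K
    rw [Set.neg_preimage, hKn] at h1
    simp only [inner_neg_left, hk.neg_pow, integral_neg] at h1
    exact h1.symm
  linarith

lemma LL_pos (hpos : ∀ θ : EE, θ ≠ 0 → ∀ k, 0 < MM K (2 * k) θ) (θ : EE) (hθ : θ ≠ 0) (k : ℕ) :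
    LL K k θ ≠ 0 := by
  intro h'
  have := hpos θ hθ k
  rw [MM_even, h'] at this
  simp at this

include hc hv h0 in
lemma lower (θ x₀ : EE) (hx₀ : x₀ ∈ K) (a : ℝ) (ha : 0 ≤ a) (hax : a < |inner ℝ x₀ θ|) :
    ∃ v : ℝ, 0 < v ∧ ∀ k, v * a ^ (2 * k) ≤ MM K (2 * k) θ := by
  set U : Set EE := {x | a < |inner ℝ x θ|} with hU
  have hUo : IsOpen U := isOpen_lt continuous_const (by fun_prop)
  have hx1 : x₀ ∈ closure (interior K) := by
    rw [hv.closure_interior_eq_closure_of_nonempty_interior ⟨0, mem_interior_iff_mem_nhds.2 h0⟩]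
    exact subset_closure hx₀
  obtain ⟨y, hyU, hyK⟩ := mem_closure_iff.1 hx1 U hUo hax
  set V := U ∩ interior K with hV
  have hVo : IsOpen V := hUo.inter isOpen_interior
  have hVK : V ⊆ K := fun x hx => interior_subset hx.2
  have hVpos : 0 < volume V := hVo.measure_pos _ ⟨y, hyU, hyK⟩
  have hVfin : volume V ≠ ∞ := ((measure_mono hVK).trans_lt hc.measure_lt_top).ne
  refine ⟨volume.real V, ENNReal.toReal_pos hVpos.ne' hVfin, fun k => ?_⟩
  calc volume.real V * a ^ (2 * k) = ∫ x in V, a ^ (2 * k) := by simp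
    _ ≤ ∫ x in V, (inner ℝ x θ : ℝ) ^ (2 * k) := by
      apply setIntegral_mono_on _ ((intK hc (2 * k) θ).mono_set hVK) hVo.measurableSet
      · intro x hx
        rw [pow_mul, pow_mul, ← sq_abs (inner ℝ x θ)]
        have : a < |inner ℝ x θ| := hx.1
        gcongr
      · exact integrableOn_const hVfin
    _ ≤ ∫ x in K, (inner ℝ x θ : ℝ) ^ (2 * k) := by
      apply setIntegral_mono_set (intK hc (2 * k) θ)
      · filter_upwards with x
        rw [pow_mul]; simp only [Pi.zero_apply]; positivity
      · exact hVK.eventuallyLE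

include hc hv h0 in
lemma MM_pos (θ : EE) (hθ : θ ≠ 0) (k : ℕ) : 0 < MM K (2 * k) θ := by
  obtain ⟨ε, hε, hb⟩ := Metric.mem_nhds_iff.1 h0
  have hn : 0 < ‖θ‖ := norm_pos_iff.2 hθ
  have hx : (ε / 2 / ‖θ‖) • θ ∈ K := by
    apply hb
    rw [mem_ball_zero_iff, norm_smul, Real.norm_of_nonneg (by positivity)]
    field_simp; linarith
  have hi : 0 < |(inner ℝ ((ε / 2 / ‖θ‖) • θ) θ : ℝ)| := by
    rw [inner_smul_left, real_inner_self_eq_norm_sq]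
    apply abs_pos.2; simp; exact ⟨hε.ne', hθ⟩
  obtain ⟨v, hv1, hv2⟩ := lower hc hv h0 θ _ hx (|(inner ℝ ((ε / 2 / ‖θ‖) • θ) θ : ℝ)| / 2)
    (by positivity) (by linarith)
  exact lt_of_lt_of_le (by positivity) (hv2 k)

include hc hv h0 hs in
lemma stepA (hn : n ≠ 0) (k : ℕ) {τ : ℝ} (hτ : 0 < τ)
    (h : ∀ x y : EE, gauge K x = gauge K y →
      volume (K ∩ ((fun z => τ • z + x) '' K)) = volume (K ∩ ((fun z => τ • z + y) '' K))) :
    ∃ C : ℝ, ∀ θ : EE, ∑ j ∈ Finset.range (2 * k + 1),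
      (-τ) ^ (2 * k - j) * ((2 * k).choose j) * (MM K j θ * MM K (2 * k - j) θ) = C * MM K (2 * k) θ := by
  have : Nonempty (Fin n) := ⟨⟨0, Nat.pos_of_ne_zero hn⟩⟩
  obtain ⟨θ₀, hθ₀⟩ := exists_ne (0 : EE)
  obtain ⟨C, hC⟩ := stepA_enn hc hv h0 hs hn k hτ h
    ⟨θ₀, LL_pos (fun θ hθ k => MM_pos hc hv h0 θ hθ k) θ₀ hθ₀ k⟩
  refine ⟨C.toReal, fun θ => ?_⟩
  rw [MM_even, ← ENNReal.toReal_mul, ← hC]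
  have hmm : Measurable (fun p : EE × EE => phi k θ (p.1 - τ • p.2)) :=
    (phi_meas k θ).comp (by fun_prop)
  have e1 : (∫⁻ w in K, ∫⁻ y in K, phi k θ (w - τ • y)) =
      ∫⁻ p, phi k θ (p.1 - τ • p.2) ∂((volume.restrict K).prod (volume.restrict K)) := by
    rw [lintegral_prod _ hmm.aemeasurable]
  rw [e1]
  unfold phi
  rw [← integral_eq_lintegral_of_nonneg_ae]
  · have e2 : ∀ p : EE × EE, (inner ℝ (p.1 - τ • p.2) θ : ℝ) ^ (2 * k) =
        ∑ j ∈ Finset.range (2 * k + 1), (-τ) ^ (2 * k - j) * ((2 * k).choose j) *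
          ((inner ℝ p.1 θ : ℝ) ^ j * (inner ℝ p.2 θ : ℝ) ^ (2 * k - j)) := by
      intro p
      have : (inner ℝ (p.1 - τ • p.2) θ : ℝ) = inner ℝ p.1 θ + (-τ) * inner ℝ p.2 θ := by
        rw [inner_sub_left, inner_smul_left]; simp; ring
      rw [this, add_pow]
      refine Finset.sum_congr rfl fun j _ => ?_
      rw [mul_pow]; ring
    simp_rw [e2]
    rw [integral_finsetSum]
    · refine Finset.sum_congr rfl fun j _ => ?_
      rw [integral_const_mul, integral_prod_mul (fun x : EE => (inner ℝ x θ : ℝ) ^ j)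
        (fun x : EE => (inner ℝ x θ : ℝ) ^ (2 * k - j))]
      rfl
    · intro j _
      exact ((intK hc j θ).mul_prod (intK hc (2 * k - j) θ)).const_mul _
  · filter_upwards with x
    rw [pow_mul]; simp only [Pi.zero_apply]; positivity
  · exact (by fun_prop : Continuous fun p : EE × EE => (inner ℝ (p.1 - τ • p.2) θ : ℝ) ^ (2 * k)).aestronglyMeasurable

lemma MM2_nonneg (θ : EE) : 0 ≤ MM K 2 θ := by
  unfold MM
  exact integral_nonneg fun x => sq_nonneg _

include hc hv h0 hs in
lemma stepB (hn : n ≠ 0) {τ : ℝ} (hτ : 0 < τ)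
    (h : ∀ x y : EE, gauge K x = gauge K y →
      volume (K ∩ ((fun z => τ • z + x) '' K)) = volume (K ∩ ((fun z => τ • z + y) '' K))) (j : ℕ) :
    ∃ m : ℝ, (Even j → 0 < m) ∧ (Odd j → m = 0) ∧
      ∀ θ : EE, MM K j θ = m * (Real.sqrt (MM K 2 θ)) ^ j := by
  have : Nonempty (Fin n) := ⟨⟨0, Nat.pos_of_ne_zero hn⟩⟩
  obtain ⟨θ₀, hθ₀⟩ := exists_ne (0 : EE)
  have hpos := fun k => MM_pos hc hv h0 θ₀ hθ₀ k
  have hs0 : 0 < Real.sqrt (MM K 2 θ₀) := Real.sqrt_pos.2 (hpos 1)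
  induction j using Nat.strong_induction_on with
  | _ j ih =>
  rcases Nat.even_or_odd j with he | ho
  swap
  · exact ⟨0, fun he => absurd he (Nat.not_even_iff_odd.2 ho), fun _ => rfl,
      fun θ => by rw [MM_odd hs j ho, zero_mul]⟩
  obtain ⟨k, hk⟩ := he.two_dvd
  subst hk
  have hno : ¬ Odd (2 * k) := Nat.not_odd_iff_even.2 he
  match k, ih, he, hno with
  | 0, _, _, hno =>
    refine ⟨MM K 0 θ₀, fun _ => hpos 0, fun ho => absurd ho hno, fun θ => ?_⟩
    simp [MM]
  | 1, _, _, hno =>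
    refine ⟨1, fun _ => one_pos, fun ho => absurd ho hno, fun θ => ?_⟩
    rw [mul_one, Real.sq_sqrt (MM2_nonneg θ), one_mul]
  | l + 2, ih, _, hno =>
    obtain ⟨C, hC⟩ := stepA hc hv h0 hs hn (l + 2) hτ h
    choose! m hm1 hm2 hm3 using ih
    have e0 : 2 * (l + 2) = 2 * l + 4 := by ring
    rw [e0] at hno hC hm1 hm2 hm3 ⊢
    set D : ℝ := ∑ i ∈ Finset.range (2 * l + 3), (-τ) ^ (2 * l + 4 - (i + 1)) *
      ((2 * l + 4).choose (i + 1)) * (m (i + 1) * m (2 * l + 4 - (i + 1))) with hD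
    have hDpos : 0 < D := by
      apply Finset.sum_pos'
      · intro i hi
        rw [Finset.mem_range] at hi
        rcases Nat.even_or_odd (i + 1) with hi' | hi'
        · have h1 : Even (2 * l + 4 - (i + 1)) := by
            rw [Nat.even_sub (by omega)]
            exact iff_of_true ⟨l + 2, by omega⟩ hi'
          have := hm1 (i + 1) (by omega) hi'
          have := hm1 (2 * l + 4 - (i + 1)) (by omega) h1
          rw [h1.neg_pow]
          positivity
        · rw [hm2 (i + 1) (by omega) hi']; simp
      · refine ⟨1, by simp, ?_⟩
        have h1 : Even (2 * l + 4 - (1 + 1)) := ⟨l + 1, by omega⟩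
        have := hm1 (1 + 1) (by omega) (by decide)
        have := hm1 (2 * l + 4 - (1 + 1)) (by omega) h1
        have h3 : 0 < (2 * l + 4).choose (1 + 1) := Nat.choose_pos (by omega)
        rw [h1.neg_pow]
        positivity
    have hM0 : ∀ θ, MM K 0 θ = MM K 0 θ₀ := fun θ => by simp [MM]
    have hev : Even (2 * l + 4) := ⟨l + 2, by omega⟩
    have key : ∀ θ : EE, D * (Real.sqrt (MM K 2 θ)) ^ (2 * l + 4) =
        (C - (1 + τ ^ (2 * l + 4)) * MM K 0 θ₀) * MM K (2 * l + 4) θ := by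
      intro θ
      have h1 := hC θ
      rw [Finset.sum_range_succ, Finset.sum_range_succ'] at h1
      simp only [Nat.choose_zero_right, Nat.choose_self, Nat.sub_zero, Nat.sub_self, pow_zero,
        hM0 θ, hev.neg_pow, Nat.cast_one] at h1
      have h2 : D * (Real.sqrt (MM K 2 θ)) ^ (2 * l + 4) =
          ∑ i ∈ Finset.range (2 * l + 3), (-τ) ^ (2 * l + 4 - (i + 1)) *
            ((2 * l + 4).choose (i + 1)) * (MM K (i + 1) θ * MM K (2 * l + 4 - (i + 1)) θ) := by
        rw [hD, Finset.sum_mul]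
        refine Finset.sum_congr rfl fun i hi => ?_
        rw [Finset.mem_range] at hi
        rw [hm3 (i + 1) (by omega) θ, hm3 (2 * l + 4 - (i + 1)) (by omega) θ]
        have : (Real.sqrt (MM K 2 θ)) ^ (2 * l + 4) = (Real.sqrt (MM K 2 θ)) ^ (i + 1) *
            (Real.sqrt (MM K 2 θ)) ^ (2 * l + 4 - (i + 1)) := by
          rw [← pow_add]; congr 1; omega
        rw [this]; ring
      rw [h2]; linarith
    have hMp : 0 < MM K (2 * l + 4) θ₀ := by rw [← e0]; exact hpos _
    have hcoef : 0 < C - (1 + τ ^ (2 * l + 4)) * MM K 0 θ₀ := by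
      have h1 := key θ₀
      have h2 : 0 < D * (Real.sqrt (MM K 2 θ₀)) ^ (2 * l + 4) := by positivity
      rw [h1] at h2
      exact (pos_iff_pos_of_mul_pos h2).2 hMp
    refine ⟨D / (C - (1 + τ ^ (2 * l + 4)) * MM K 0 θ₀), fun _ => by positivity,
      fun ho => absurd ho hno, fun θ => ?_⟩
    rw [div_mul_eq_mul_div, key θ, mul_div_cancel_left₀ _ hcoef.ne']

include hc hv h0 in
lemma cmp (hB : ∀ j : ℕ, ∃ m : ℝ, ∀ θ : EE, MM K j θ = m * (Real.sqrt (MM K 2 θ)) ^ j)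
    (θ θ' : EE) (hθ' : θ' ≠ 0) (b : ℝ) (hb : 0 ≤ b)
    (h : ∀ y ∈ K, |(inner ℝ y θ' : ℝ)| ≤ b * Real.sqrt (MM K 2 θ')) (x : EE) (hx : x ∈ K) :
    |(inner ℝ x θ : ℝ)| ≤ b * Real.sqrt (MM K 2 θ) := by
  by_contra! hlt
  obtain ⟨a, ha1, ha2⟩ := exists_between hlt
  set s := Real.sqrt (MM K 2 θ)
  set s' := Real.sqrt (MM K 2 θ')
  have hs0 : 0 ≤ s := Real.sqrt_nonneg _
  have hs' : 0 < s' := Real.sqrt_pos.2 (MM_pos hc hv h0 θ' hθ' 1)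
  have hc0 : 0 ≤ b * s := mul_nonneg hb hs0
  have ha : 0 < a := hc0.trans_lt ha1
  obtain ⟨v, hv1, hv2⟩ := lower hc hv h0 θ x hx a ha.le ha2
  set W := volume.real K
  have hW : 0 ≤ W := measureReal_nonneg
  have hall : ∀ k, v * a ^ (2 * k) ≤ W * (b * s) ^ (2 * k) := by
    intro k
    obtain ⟨m, hm⟩ := hB (2 * k)
    have h1 : m * s' ^ (2 * k) ≤ W * (b * s') ^ (2 * k) := by
      rw [← hm θ']
      calc MM K (2 * k) θ' ≤ ∫ x in K, (b * s') ^ (2 * k) := by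
            apply setIntegral_mono_on (intK hc (2 * k) θ') _ hc.measurableSet
            · intro y hy
              rw [pow_mul, pow_mul, ← sq_abs (inner ℝ y θ')]
              have := h y hy
              gcongr
            · exact integrableOn_const hc.measure_lt_top.ne
        _ = _ := by simp [W]
    have h2 : m ≤ W * b ^ (2 * k) := by
      rw [mul_pow, ← mul_assoc] at h1
      exact le_of_mul_le_mul_right h1 (by positivity)
    calc v * a ^ (2 * k) ≤ m * s ^ (2 * k) := by rw [← hm θ]; exact hv2 k
      _ ≤ W * b ^ (2 * k) * s ^ (2 * k) := by gcongr
      _ = _ := by rw [mul_pow]; ring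
  have hr : ((b * s) / a) ^ 2 < 1 := by
    apply pow_lt_one₀ (by positivity) _ two_ne_zero
    rw [div_lt_one ha]; exact ha1
  obtain ⟨k, hk⟩ := exists_pow_lt_of_lt_one (show 0 < v / (W + 1) by positivity) hr
  rw [← pow_mul, div_pow, div_lt_div_iff₀ (by positivity) (by positivity)] at hk
  have := hall k
  have : 0 ≤ (b * s) ^ (2 * k) := by positivity
  nlinarith

include hc hv h0 hs in
lemma stepC (hn : n ≠ 0)
    (hB : ∀ j : ℕ, ∃ m : ℝ, ∀ θ : EE, MM K j θ = m * (Real.sqrt (MM K 2 θ)) ^ j) :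
    ∃ b : ℝ, 0 < b ∧ ∀ x : EE, x ∈ K ↔ ∀ θ : EE, (inner ℝ x θ : ℝ) ≤ b * Real.sqrt (MM K 2 θ) := by
  have : Nonempty (Fin n) := ⟨⟨0, Nat.pos_of_ne_zero hn⟩⟩
  obtain ⟨θ₀, hθ₀⟩ := exists_ne (0 : EE)
  have hsp : ∀ θ : EE, θ ≠ 0 → 0 < Real.sqrt (MM K 2 θ) :=
    fun θ hθ => Real.sqrt_pos.2 (MM_pos hc hv h0 θ hθ 1)
  have h0K : (0 : EE) ∈ K := mem_of_mem_nhds h0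
  obtain ⟨y₀, hy₀, hmax⟩ := hc.exists_isMaxOn ⟨0, h0K⟩
    (f := fun y : EE => |(inner ℝ y θ₀ : ℝ)|) (by fun_prop)
  have hmax' : ∀ y ∈ K, |(inner ℝ y θ₀ : ℝ)| ≤ |(inner ℝ y₀ θ₀ : ℝ)| := fun y hy => hmax hy
  set b := |(inner ℝ y₀ θ₀ : ℝ)| / Real.sqrt (MM K 2 θ₀) with hb
  have hb0 : 0 ≤ b := div_nonneg (abs_nonneg _) (Real.sqrt_nonneg _)
  have hbs : b * Real.sqrt (MM K 2 θ₀) = |(inner ℝ y₀ θ₀ : ℝ)| :=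
    div_mul_cancel₀ _ (hsp θ₀ hθ₀).ne'
  have hle : ∀ x ∈ K, ∀ θ : EE, |(inner ℝ x θ : ℝ)| ≤ b * Real.sqrt (MM K 2 θ) := by
    intro x hx θ
    exact cmp hc hv h0 hB θ θ₀ hθ₀ b hb0 (fun y hy => by rw [hbs]; exact hmax' y hy) x hx
  refine ⟨b, lt_of_le_of_ne hb0 ?_, fun x => ⟨fun hx θ => (le_abs_self _).trans (hle x hx θ), fun hx => ?_⟩⟩
  · intro hb1
    have h2 := MM_pos hc hv h0 θ₀ hθ₀ 1
    have : MM K (2 * 1) θ₀ = 0 := by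
      unfold MM
      rw [setIntegral_congr_fun hc.measurableSet (g := fun _ => (0 : ℝ))]
      · simp
      · intro x hx
        have := hle x hx θ₀
        rw [← hb1, zero_mul] at this
        have h3 : (inner ℝ x θ₀ : ℝ) = 0 := abs_eq_zero.1 (le_antisymm this (abs_nonneg _))
        simp [h3]
    linarith
  · by_contra hxK
    obtain ⟨f, u, hf1, hf2⟩ := geometric_hahn_banach_closed_point hv hc.isClosed hxK
    obtain ⟨θ, hθ⟩ := (InnerProductSpace.toDual ℝ EE).surjective f
    have hfi : ∀ y, f y = inner ℝ y θ := by
      intro y; rw [← hθ, InnerProductSpace.toDual_apply_apply, real_inner_comm]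
    simp only [hfi] at hf1 hf2
    have hu : 0 < u := by simpa using hf1 0 h0K
    have hθ0 : θ ≠ 0 := by
      rintro rfl
      simp at hf2; linarith
    have hsθ := hsp θ hθ0
    have h1 := cmp hc hv h0 hB θ₀ θ hθ0 (u / Real.sqrt (MM K 2 θ)) (by positivity) (by
      intro y hy
      rw [div_mul_cancel₀ _ hsθ.ne', abs_le]
      have h2 := hf1 _ (hs y hy)
      rw [inner_neg_left] at h2
      exact ⟨by linarith, (hf1 y hy).le⟩) y₀ hy₀
    rw [← hbs] at h1
    have h2 := le_of_mul_le_mul_right h1 (hsp θ₀ hθ₀)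
    rw [le_div_iff₀ hsθ] at h2
    have h3 := hx θ
    linarith

open scoped MatrixOrder in
include hc in
lemma exB : ∃ B : EE →ₗ[ℝ] EE, ∀ θ, ‖B θ‖ = Real.sqrt (MM K 2 θ) := by
  set A : Matrix (Fin n) (Fin n) ℝ := fun i j => ∫ x in K, x i * x j with hA
  have hint : ∀ i j : Fin n, IntegrableOn (fun x : EE => x i * x j) K := fun i j =>
    ContinuousOn.integrableOn_compact hc (by fun_prop)
  have hMA : ∀ θ : EE, MM K 2 θ = ∑ i, ∑ j, θ i * θ j * A i j := by
    intro θ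
    have e : ∀ x : EE, (inner ℝ x θ : ℝ) ^ 2 = ∑ i, ∑ j, θ i * θ j * (x i * x j) := by
      intro x
      rw [PiLp.inner_apply, sq, Finset.sum_mul_sum]
      refine Finset.sum_congr rfl fun i _ => Finset.sum_congr rfl fun j _ => ?_
      simp; ring
    unfold MM
    simp_rw [e]
    rw [integral_finsetSum]
    · refine Finset.sum_congr rfl fun i _ => ?_
      rw [integral_finsetSum]
      · refine Finset.sum_congr rfl fun j _ => ?_
        rw [integral_const_mul]
      · exact fun j _ => (hint i j).const_mul _
    · exact fun i _ => integrable_finsetSum _ fun j _ => (hint i j).const_mul _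
  have hpsd : A.PosSemidef := by
    apply Matrix.PosSemidef.of_dotProduct_mulVec_nonneg
    · ext i j
      rw [Matrix.conjTranspose_apply]
      simp only [hA, star_trivial, mul_comm]
    · intro v
      have h1 := hMA (WithLp.toLp 2 v)
      have h2 := MM2_nonneg (K := K) (WithLp.toLp 2 v)
      rw [h1] at h2
      refine h2.trans_eq ?_
      simp only [dotProduct, Matrix.mulVec, Finset.mul_sum]
      refine Finset.sum_congr rfl fun i _ => Finset.sum_congr rfl fun j _ => ?_
      rw [Pi.star_apply, star_trivial]; ring
  obtain ⟨B, hB⟩ := CStarAlgebra.nonneg_iff_eq_star_mul_self.mp hpsd.nonneg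
  refine ⟨Matrix.toEuclideanLin B, fun θ => ?_⟩
  rw [EuclideanSpace.norm_eq, hMA]
  congr 1
  have hBij : ∀ i j, A i j = ∑ l, B l i * B l j := by
    intro i j
    rw [hB, Matrix.mul_apply]; simp [Matrix.star_apply]
  simp_rw [hBij, Finset.mul_sum]
  have : ∀ l, ‖(Matrix.toEuclideanLin B θ) l‖ ^ 2 = ∑ i, ∑ j, θ i * θ j * (B l i * B l j) := by
    intro l
    rw [Real.norm_eq_abs, sq_abs, Matrix.ofLp_toEuclideanLin_apply, Matrix.mulVec, dotProduct, sq,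
      Finset.sum_mul_sum]
    refine Finset.sum_congr rfl fun i _ => Finset.sum_congr rfl fun j _ => ?_
    ring
  simp_rw [this]
  rw [Finset.sum_comm]
  refine Finset.sum_congr rfl fun i _ => ?_
  rw [Finset.sum_comm]

end body
end MRS

theorem meyer_reisner_schmuckenschlager {n : ℕ}
    (K : Set (EuclideanSpace ℝ (Fin n)))
    (hKcomp : IsCompact K) (hKconv : Convex ℝ K) (hKint : (interior K).Nonempty)
    (hsymm : K = -K) (τ : ℝ) (hτ : 0 < τ)
    (h : ∀ x y : EuclideanSpace ℝ (Fin n), gauge K x = gauge K y →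
      volume (K ∩ ((fun z => τ • z + x) '' K)) =
        volume (K ∩ ((fun z => τ • z + y) '' K))) :
    ∃ T : EuclideanSpace ℝ (Fin n) ≃ₗ[ℝ] EuclideanSpace ℝ (Fin n),
      K = ⇑T '' Metric.closedBall (0 : EuclideanSpace ℝ (Fin n)) 1 := by
  by_cases hn : n = 0
  · subst hn
    refine ⟨LinearEquiv.refl ℝ _, ?_⟩
    obtain ⟨x, hx⟩ := hKint
    ext y
    constructor
    · intro _
      exact ⟨y, by simp [Subsingleton.elim y 0], rfl⟩
    · intro _
      rw [Subsingleton.elim y x]; exact interior_subset hx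
  have hs : ∀ x ∈ K, -x ∈ K := by
    intro x hx; rw [hsymm] at hx; exact hx
  have h0 : K ∈ nhds 0 := by
    obtain ⟨x, hx⟩ := hKint
    have hx' : -x ∈ interior K := by
      have h1 : (Homeomorph.neg (EuclideanSpace ℝ (Fin n))) ⁻¹' K = K := hsymm.symm
      rw [← h1, ← Homeomorph.preimage_interior]
      simpa using hx
    rw [← mem_interior_iff_mem_nhds]
    have := hKconv.interior hx hx' (a := 1 / 2) (b := 1 / 2) (by norm_num) (by norm_num) (by norm_num)
    simpa using this
  have hB : ∀ j : ℕ, ∃ m : ℝ, ∀ θ : EuclideanSpace ℝ (Fin n),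
      MRS.MM K j θ = m * (Real.sqrt (MRS.MM K 2 θ)) ^ j := fun j => by
    obtain ⟨m, -, -, hm⟩ := MRS.stepB hKcomp hKconv h0 hs hn hτ h j
    exact ⟨m, hm⟩
  obtain ⟨b, hb, hK⟩ := MRS.stepC hKcomp hKconv h0 hs hn hB
  obtain ⟨B, hBn⟩ := MRS.exB hKcomp
  have hinj : Function.Injective (b • B) := by
    rw [injective_iff_map_eq_zero]
    intro θ hθ
    by_contra hne
    have h1 : B θ = 0 := by simpa [hb.ne'] using hθ
    have h2 := hBn θ
    rw [h1, norm_zero] at h2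
    have h3 := Real.sqrt_pos.2 (MRS.MM_pos hKcomp hKconv h0 θ hne 1)
    rw [mul_one] at h3
    linarith
  set e := LinearEquiv.ofInjectiveEndo (b • B) hinj with he
  have hen : ∀ θ, ‖e θ‖ = b * Real.sqrt (MRS.MM K 2 θ) := by
    intro θ
    change ‖b • B θ‖ = _
    rw [norm_smul, hBn, Real.norm_of_nonneg hb.le]
  have hker : Function.Injective (LinearMap.adjoint (e : EuclideanSpace ℝ (Fin n) →ₗ[ℝ] EuclideanSpace ℝ (Fin n))) := by
    rw [injective_iff_map_eq_zero]
    intro y hy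
    have h1 : inner ℝ (LinearMap.adjoint (e : EuclideanSpace ℝ (Fin n) →ₗ[ℝ] EuclideanSpace ℝ (Fin n)) y) (e.symm y) = (0 : ℝ) := by
      rw [hy, inner_zero_left]
    rw [LinearMap.adjoint_inner_left] at h1
    simpa using h1
  refine ⟨LinearEquiv.ofInjectiveEndo _ hker, ?_⟩
  set T := LinearEquiv.ofInjectiveEndo _ hker with hT
  have hTi : ∀ y θ, (inner ℝ (T y) θ : ℝ) = inner ℝ y (e θ) := by
    intro y θ
    exact LinearMap.adjoint_inner_left _ _ _
  ext x
  rw [hK]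
  obtain ⟨y, rfl⟩ := T.surjective x
  rw [T.injective.mem_set_image, mem_closedBall_zero_iff]
  simp_rw [hTi, ← hen]
  constructor
  · intro hy
    have h1 := hy (e.symm y)
    rw [e.apply_symm_apply, real_inner_self_eq_norm_sq] at h1
    by_contra! hlt
    nlinarith
  · intro hy θ
    calc (inner ℝ y (e θ) : ℝ) ≤ ‖y‖ * ‖e θ‖ := real_inner_le_norm _ _
      _ ≤ 1 * ‖e θ‖ := by gcongr
      _ = _ := one_mul _
end

section
/- Let K be a convex body in ℝ^n with the origin in its interior, and suppose there exists λ ∈ (0,1) such that the function x ↦ vol_n(conv(K ∪ (λK + x))) depends only on the Euclidean norm ‖x‖, i.e. whenever ‖x‖ = ‖y‖ one has vol_n(conv(K ∪ (λK + x))) = vol_n(conv(K ∪ (λK + y))). Then K is a closed Euclidean ball centred at the origin. -/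
open MeasureTheory Pointwise

theorem castro_aux {n : ℕ}
    (K : Set (EuclideanSpace ℝ (Fin n)))
    (hKcomp : IsCompact K) (hKconv : Convex ℝ K)
    (h0 : (0 : EuclideanSpace ℝ (Fin n)) ∈ interior K)
    (l : ℝ) (hl : l ∈ Set.Ioo (0 : ℝ) 1) (w : EuclideanSpace ℝ (Fin n)) :
    w ∈ K ↔ volume (convexHull ℝ (K ∪ (fun z => l • z + (1 - l) • w) '' K)) = volume K := by
  obtain ⟨hl0, hl1⟩ := hl
  have hK0 : (0 : EuclideanSpace ℝ (Fin n)) ∈ K := interior_subset h0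
  constructor
  · intro hw
    congr 1
    have : K ∪ (fun z => l • z + (1 - l) • w) '' K = K := by
      apply Set.union_eq_left.2
      rintro _ ⟨z, hz, rfl⟩
      exact hKconv hz hw hl0.le (by linarith) (by ring)
    rw [this, hKconv.convexHull_eq]
  · intro hv
    set C := convexHull ℝ (K ∪ (fun z => l • z + (1 - l) • w) '' K) with hC
    have hKC : K ⊆ C := Set.subset_union_left.trans (subset_convexHull ℝ _)
    have hCK : C ⊆ K := by
      intro p hp
      by_contra hpK
      have hCc : Convex ℝ C := convex_convexHull ℝ _
      have hne : (interior C).Nonempty := ⟨0, interior_mono hKC h0⟩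
      have hpcl : p ∈ closure (interior C) := by
        rw [hCc.closure_interior_eq_closure_of_nonempty_interior hne]
        exact subset_closure hp
      obtain ⟨q, hq1, hq2⟩ := mem_closure_iff.1 hpcl Kᶜ hKcomp.isClosed.isOpen_compl hpK
      have hpos : 0 < volume (Kᶜ ∩ interior C) :=
        (hKcomp.isClosed.isOpen_compl.inter isOpen_interior).measure_pos volume ⟨q, hq1, hq2⟩
      have hle : volume (K ∪ (Kᶜ ∩ interior C)) ≤ volume K := by
        rw [← hv]
        apply measure_mono
        exact Set.union_subset hKC (Set.inter_subset_right.trans interior_subset)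
      rw [measure_union (Set.disjoint_left.2 fun a ha hb => hb.1 ha)
        (hKcomp.isClosed.isOpen_compl.inter isOpen_interior).measurableSet] at hle
      have hlt := ENNReal.lt_add_right (hKcomp.measure_lt_top (μ := volume)).ne hpos.ne'
      exact absurd hle (not_le.2 hlt)
    have hT : ∀ z ∈ K, l • z + (1 - l) • w ∈ K := fun z hz =>
      hCK (subset_convexHull ℝ _ (Or.inr ⟨z, hz, rfl⟩))
    have hk : ∀ k : ℕ, (1 - l ^ k) • w ∈ K := by
      intro k
      induction k with
      | zero => simpa using hK0
      | succ k ih =>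
        have := hT _ ih
        rw [smul_smul, ← add_smul] at this
        convert this using 2
        ring
    have hlim : Filter.Tendsto (fun k : ℕ => (1 - l ^ k) • w) Filter.atTop (nhds w) := by
      have := ((tendsto_pow_atTop_nhds_zero_of_lt_one hl0.le hl1).const_sub 1).smul_const w
      simpa using this
    exact hKcomp.isClosed.mem_of_tendsto hlim (Filter.Eventually.of_forall hk)

theorem castro_euclidean_norm {n : ℕ}
    (K : Set (EuclideanSpace ℝ (Fin n)))
    (hKcomp : IsCompact K) (hKconv : Convex ℝ K) (hKint : (interior K).Nonempty)
    (h0 : (0 : EuclideanSpace ℝ (Fin n)) ∈ interior K)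
    (l : ℝ) (hl : l ∈ Set.Ioo (0 : ℝ) 1)
    (h : ∀ x y : EuclideanSpace ℝ (Fin n), ‖x‖ = ‖y‖ →
      volume (convexHull ℝ (K ∪ (fun z => l • z + x) '' K)) =
        volume (convexHull ℝ (K ∪ (fun z => l • z + y) '' K))) :
    ∃ r : ℝ, K = Metric.closedBall (0 : EuclideanSpace ℝ (Fin n)) r := by
  have hK0 : (0 : EuclideanSpace ℝ (Fin n)) ∈ K := interior_subset h0
  have hinv : ∀ x y : EuclideanSpace ℝ (Fin n), ‖x‖ = ‖y‖ → x ∈ K → y ∈ K := by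
    intro x y hxy hx
    rw [castro_aux K hKcomp hKconv h0 l hl] at hx ⊢
    rw [← hx]
    apply h
    rw [norm_smul, norm_smul, hxy]
  obtain ⟨x₀, hx₀, hmax⟩ := hKcomp.exists_isMaxOn ⟨0, hK0⟩ continuous_norm.continuousOn
  refine ⟨‖x₀‖, Set.Subset.antisymm (fun y hy => ?_) (fun y hy => ?_)⟩
  · simpa using hmax hy
  · have hy' : ‖y‖ ≤ ‖x₀‖ := by simpa using hy
    by_cases hy0 : y = 0
    · rwa [hy0]
    have hyp : 0 < ‖y‖ := norm_pos_iff.2 hy0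
    have hxp : 0 < ‖x₀‖ := hyp.trans_le hy'
    have h1 : (‖x₀‖ / ‖y‖) • y ∈ K := by
      apply hinv x₀ _ _ hx₀
      rw [norm_smul, Real.norm_of_nonneg (by positivity)]
      field_simp
    have h2 := hKconv.smul_mem_of_zero_mem hK0 h1
      (t := ‖y‖ / ‖x₀‖) ⟨by positivity, (div_le_one hxp).2 hy'⟩
    rw [smul_smul] at h2
    have : ‖y‖ / ‖x₀‖ * (‖x₀‖ / ‖y‖) = 1 := by field_simp
    rwa [this, one_smul] at h2
end

section
/- Let K be a convex body in ℝ^n with the origin in its interior, and let L ⊂ ℝ^n be a convex body that is centrally symmetric with centre the origin (L = −L). Suppose there exists λ ∈ (0,1) such that the function x ↦ vol_n(conv(K ∪ (λK + x))) depends only on the Minkowski norm ‖x‖_L, i.e. whenever ‖x‖_L = ‖y‖_L one has vol_n(conv(K ∪ (λK + x))) = vol_n(conv(K ∪ (λK + y))). Then L is homothetic to K, i.e. L = μK + v for some μ > 0 and v ∈ ℝ^n. -/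
open MeasureTheory Pointwise

theorem castro_minkowski_norm {n : ℕ}
    (K : Set (EuclideanSpace ℝ (Fin n)))
    (hKcomp : IsCompact K) (hKconv : Convex ℝ K) (hKint : (interior K).Nonempty)
    (h0 : (0 : EuclideanSpace ℝ (Fin n)) ∈ interior K)
    (L : Set (EuclideanSpace ℝ (Fin n)))
    (hLcomp : IsCompact L) (hLconv : Convex ℝ L) (hLint : (interior L).Nonempty)
    (hLsymm : L = -L)
    (l : ℝ) (hl : l ∈ Set.Ioo (0 : ℝ) 1)
    (h : ∀ x y : EuclideanSpace ℝ (Fin n), gauge L x = gauge L y →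
      volume (convexHull ℝ (K ∪ (fun z => l • z + x) '' K)) =
        volume (convexHull ℝ (K ∪ (fun z => l • z + y) '' K))) :
    ∃ (μ : ℝ) (v : EuclideanSpace ℝ (Fin n)), 0 < μ ∧
      L = (fun x => μ • x + v) '' K := by
  obtain ⟨hl0, hl1⟩ := hl
  have h0K : (0 : EuclideanSpace ℝ (Fin n)) ∈ K := interior_subset h0
  have h1l : 0 < 1 - l := by linarith
  -- containment gives equality of hull
  have hA : ∀ k ∈ K, convexHull ℝ (K ∪ (fun z => l • z + (1 - l) • k) '' K) = K := by
    intro k hk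
    rw [Set.union_eq_self_of_subset_right, hKconv.convexHull_eq]
    rintro _ ⟨z, hz, rfl⟩
    exact hKconv hz hk hl0.le h1l.le (by ring)
  have hB : ∀ x, volume (convexHull ℝ (K ∪ (fun z => l • z + x) '' K)) = volume K →
      (1 - l)⁻¹ • x ∈ K := by
    intro x hx
    set C := convexHull ℝ (K ∪ (fun z => l • z + x) '' K) with hC
    have hCc : Convex ℝ C := convex_convexHull ℝ _
    have hKC : K ⊆ C := Set.subset_union_left.trans (subset_convexHull ℝ _)
    have hd : volume (C \ K) = 0 := by
      rw [measure_diff hKC hKcomp.measurableSet.nullMeasurableSet hKcomp.measure_lt_top.ne, hx,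
        tsub_self]
    have ho : interior C \ K = ∅ := by
      have : IsOpen (interior C \ K) := isOpen_interior.sdiff hKcomp.isClosed
      rw [← this.measure_eq_zero_iff volume]
      exact measure_mono_null (Set.diff_subset_diff_left interior_subset) hd
    have hCK : C ⊆ K := by
      calc C ⊆ closure C := subset_closure
        _ = closure (interior C) :=
          (hCc.closure_interior_eq_closure_of_nonempty_interior
            (hKint.mono (interior_mono hKC))).symm
        _ ⊆ K := closure_minimal (Set.diff_eq_empty.1 ho) hKcomp.isClosed
    have hm : ∀ z ∈ K, l • z + x ∈ K := fun z hz =>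
      hCK (subset_convexHull ℝ _ (Or.inr ⟨z, hz, rfl⟩))
    have hs : ∀ m : ℕ, ((1 - l ^ m) * (1 - l)⁻¹) • x ∈ K := by
      intro m
      induction m with
      | zero => simpa using h0K
      | succ m ih =>
        convert hm _ ih using 1
        rw [smul_smul]
        nth_rw 3 [← one_smul ℝ x]
        rw [← add_smul]
        congr 1
        field_simp
        ring
    refine hKcomp.isClosed.mem_of_tendsto (b := Filter.atTop) ?_ (Filter.Eventually.of_forall hs)
    have := tendsto_pow_atTop_nhds_zero_of_lt_one hl0.le hl1
    have h2 := ((this.const_sub 1).mul_const (1 - l)⁻¹).smul_const x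
    simpa using h2
  rcases subsingleton_or_nontrivial (EuclideanSpace ℝ (Fin n)) with hsub | hnt
  · refine ⟨1, 0, one_pos, ?_⟩
    rw [Set.Nonempty.eq_univ (hLint.mono interior_subset)]
    exact (Set.Nonempty.eq_univ (Set.Nonempty.image _ ⟨0, h0K⟩)).symm
  have hneg : ∀ x ∈ L, -x ∈ L := fun x hx => by rw [hLsymm]; simpa using hx
  have hL0 : (0 : EuclideanSpace ℝ (Fin n)) ∈ interior L := by
    obtain ⟨a, ha⟩ := hLint
    have h2 := hLconv.combo_interior_self_mem_interior ha (hneg a (interior_subset ha))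
      (a := 1/2) (b := 1/2) (by norm_num) (by norm_num) (by norm_num)
    simpa using h2
  have hLn : L ∈ nhds (0 : EuclideanSpace ℝ (Fin n)) := mem_interior_iff_mem_nhds.1 hL0
  have hcont : Continuous (gauge L) := continuous_gauge hLconv hLn
  obtain ⟨k0, hk0, hmax⟩ := hKcomp.exists_isMaxOn ⟨0, h0K⟩ hcont.continuousOn
  have hpos : 0 < gauge L k0 := by
    obtain ⟨e, he⟩ := exists_ne (0 : EuclideanSpace ℝ (Fin n))
    have habs : Absorbent ℝ K := absorbent_nhds_zero (mem_interior_iff_mem_nhds.1 h0)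
    obtain ⟨k, hk, hk0'⟩ : ∃ k ∈ K, k ≠ 0 := by
      by_contra! hcon
      have hK0 : K ∈ nhds (0 : EuclideanSpace ℝ (Fin n)) := mem_interior_iff_mem_nhds.1 h0
      have : ({0} : Set (EuclideanSpace ℝ (Fin n))) ∈ nhds 0 :=
        Filter.mem_of_superset hK0 (fun z hz => hcon z hz)
      have := absorbent_nhds_zero (𝕜 := ℝ) this
      obtain ⟨r, hr, hr'⟩ := this.gauge_set_nonempty (x := e)
      simp at hr'
      exact he hr'
    refine lt_of_lt_of_le ?_ (hmax hk)
    exact (gauge_pos (absorbent_nhds_zero hLn)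
      (NormedSpace.isVonNBounded_of_isBounded ℝ hLcomp.isBounded)).2 hk0'
  set r := gauge L k0 with hr
  have key : ∀ y, y ∈ K ↔ gauge L y ≤ r := by
    intro y
    refine ⟨fun hy => hmax hy, fun hy => ?_⟩
    have ht0 : 0 ≤ gauge L y / r := div_nonneg (gauge_nonneg _) hpos.le
    have ht1 : gauge L y / r ≤ 1 := (div_le_one hpos).2 hy
    have hk : (gauge L y / r) • k0 ∈ K := hKconv.smul_mem_of_zero_mem h0K hk0 ⟨ht0, ht1⟩
    have hg : gauge L ((1 - l) • y) = gauge L ((1 - l) • ((gauge L y / r) • k0)) := by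
      rw [gauge_smul_of_nonneg h1l.le, gauge_smul_of_nonneg h1l.le, gauge_smul_of_nonneg ht0,
        ← hr, smul_eq_mul (gauge L y / r), div_mul_cancel₀ _ hpos.ne']
    have := hB ((1 - l) • y) ((h _ _ hg).trans (by rw [hA _ hk]))
    rwa [smul_smul, inv_mul_cancel₀ h1l.ne', one_smul] at this
  have hLm : ∀ y, y ∈ L ↔ gauge L y ≤ 1 := by
    intro y
    rw [gauge_le_one_iff_mem_closure hLconv hLn, hLcomp.isClosed.closure_eq]
  refine ⟨r⁻¹, 0, inv_pos.2 hpos, ?_⟩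
  ext y
  constructor
  · intro hy
    refine ⟨r • y, ?_, ?_⟩
    · rw [key, gauge_smul_of_nonneg hpos.le, smul_eq_mul]
      have := (hLm y).1 hy
      nlinarith
    · simp [smul_smul, inv_mul_cancel₀ hpos.ne']
  · rintro ⟨k, hk, rfl⟩
    rw [hLm]
    simp only [add_zero]
    rw [gauge_smul_of_nonneg (inv_pos.2 hpos).le, smul_eq_mul, inv_mul_le_iff₀ hpos, mul_one]
    exact (key k).1 hk
end
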